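/- arXiv:1104.2072 — 2 statements merged into one kernel-verified Lean document; each statement's English description precedes it below -/
import Mathlib

section
/- Let k be a solid and incremental assignment. Then 𝒥_k ⊕ 𝒫_k = Π, i.e., 𝒥_k ∩ 𝒫_k = {0} and 𝒥_k + 𝒫_k = Π (so that 𝒫_k and 𝒟_k are dual to each other under the pairing ⟨·,·⟩). -/
open MvPolynomial

noncomputable section

/-- The linear polynomial `p_x : t ↦ x ⬝ t`. -/
def pLin (n : ℕ) (x : Fin n → ℝ) : MvPolynomial (Fin n) ℝ :=
  ∑ i, MvPolynomial.C (x i) * MvPolynomial.X i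

/-- `p_Z = ∏_{x ∈ Z} p_x` for a sub-multiset `Z` of the multiset indexed by `ι`. -/
def pProd (n : ℕ) {ι : Type} (v : ι → Fin n → ℝ) (Z : Finset ι) : MvPolynomial (Fin n) ℝ :=
  ∏ a ∈ Z, pLin n (v a)

/-- `q_Z = ∏_{x ∈ Z} (p_x - λ_x)`. -/
def qProd (n : ℕ) {ι : Type} (v : ι → Fin n → ℝ) (lam : ι → ℝ) (Z : Finset ι) :
    MvPolynomial (Fin n) ℝ :=
  ∏ a ∈ Z, (pLin n (v a) - MvPolynomial.C (lam a))

/-- The pairing `⟨p,q⟩ = (p(∂)q)(0) = ∑_α α! p_α q_α`. -/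
def pairing (n : ℕ) (p q : MvPolynomial (Fin n) ℝ) : ℝ :=
  ∑ α ∈ p.support, p.coeff α * q.coeff α * (α.prod fun _ e => (Nat.factorial e : ℝ))

/-- `B` is a basis of the multiset: its vectors form a basis of `ℝ^n`. -/
def IsBasisSet (n : ℕ) {ι : Type} (v : ι → Fin n → ℝ) (B : Finset ι) : Prop :=
  LinearIndependent ℝ (fun b : B => v b) ∧ Submodule.span ℝ (v '' ↑B) = ⊤

/-- The ideal `𝒥_{𝔹'}` generated by the `p_Z` over all `Z` meeting every `B ∈ 𝔹'`. -/
def Jideal (n : ℕ) {ι : Type} [DecidableEq ι] (v : ι → Fin n → ℝ) (𝔹' : Set (Finset ι)) :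
    Ideal (MvPolynomial (Fin n) ℝ) :=
  Ideal.span {p | ∃ Z : Finset ι, (∀ B ∈ 𝔹', (Z ∩ B).Nonempty) ∧ p = pProd n v Z}

/-- The kernel space `𝒟_{𝔹'}`. -/
def Dspace (n : ℕ) {ι : Type} [DecidableEq ι] (v : ι → Fin n → ℝ) (𝔹' : Set (Finset ι)) :
    Submodule ℝ (MvPolynomial (Fin n) ℝ) where
  carrier := {f | ∀ g ∈ Jideal n v 𝔹', pairing n g f = 0}
  zero_mem' := by intro g _; simp [pairing]
  add_mem' := by
    intro a b ha hb g hg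
    have h : pairing n g (a + b) = pairing n g a + pairing n g b := by
      simp only [pairing, MvPolynomial.coeff_add]
      rw [← Finset.sum_add_distrib]
      exact Finset.sum_congr rfl fun α _ => by ring
    rw [h, ha g hg, hb g hg, add_zero]
  smul_mem' := by
    intro c f hf g hg
    have h : pairing n g (c • f) = c * pairing n g f := by
      simp only [pairing, MvPolynomial.coeff_smul, smul_eq_mul, Finset.mul_sum]
      exact Finset.sum_congr rfl fun α _ => by ring
    rw [h, hf g hg, mul_zero]

/-- A solid assignment `k : 2^X → ℕ`. -/
def Solid (n : ℕ) {ι : Type} (v : ι → Fin n → ℝ) (k : Finset ι → ℕ) : Prop :=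
  ∀ Z Z' : Finset ι,
    Submodule.span ℝ (v '' ↑Z) ≤ Submodule.span ℝ (v '' ↑Z') → k Z ≤ k Z'

/-- An incremental assignment. -/
def Incremental {ι : Type} [DecidableEq ι] (k : Finset ι → ℕ) : Prop :=
  ∀ (Z : Finset ι) (x : ι), k (insert x Z) ≤ k Z + 1

/-- `m(I) = k(I) + n - #I`. -/
def mVal (n : ℕ) {ι : Type} (k : Finset ι → ℕ) (I : Finset ι) : ℕ := k I + n - I.card

/-- `B ∩ X` for `B ⊆ X ∪ Y`. -/
def leftPart {ι : Type} [Fintype ι] [DecidableEq ι] {M : ℕ} (B : Finset (ι ⊕ Fin M)) :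
    Finset ι :=
  Finset.univ.filter fun i => Sum.inl i ∈ B

/-- `B ∩ Y` for `B ⊆ X ∪ Y`, as a set of indices in `Y`. -/
def rightPart {ι : Type} [Fintype ι] [DecidableEq ι] {M : ℕ} (B : Finset (ι ⊕ Fin M)) :
    Finset (Fin M) :=
  Finset.univ.filter fun j => Sum.inr j ∈ B

/-- `Y_i = {y_1, …, y_i}` as a set of indices. -/
def YFin {M : ℕ} (i : ℕ) : Finset (Fin M) := Finset.univ.filter fun j => (j : ℕ) < i

/-- `X ∪ Y_i` as a subset of the index set of `X ∪ Y`. -/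
def XYup (ι : Type) [Fintype ι] [DecidableEq ι] (M : ℕ) (i : ℕ) : Finset (ι ⊕ Fin M) :=
  Finset.univ.image Sum.inl ∪ (YFin (M := M) i).image Sum.inr

/-- `Y` is in general position in `X ∪ Y`: no `y ∈ Y` lies in the span of fewer than `n`
vectors of `(X ∪ Y) ∖ {y}`. -/
def GeneralPosition (n : ℕ) {ι : Type} [Fintype ι] [DecidableEq ι] {M : ℕ}
    (v : ι → Fin n → ℝ) (y : Fin M → Fin n → ℝ) : Prop :=
  ∀ (j : Fin M) (S : Finset (ι ⊕ Fin M)), Sum.inr j ∉ S → S.card < n →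
    y j ∉ Submodule.span ℝ (Sum.elim v y '' ↑S)

/-- `𝔹_k : the bases `B` of `X ∪ Y` with `B ∩ Y ⊆ Y_{m(B ∩ X)}`. -/
def Bk (n : ℕ) {ι : Type} [Fintype ι] [DecidableEq ι] (v : ι → Fin n → ℝ) {M : ℕ}
    (y : Fin M → Fin n → ℝ) (k : Finset ι → ℕ) : Set (Finset (ι ⊕ Fin M)) :=
  {B | IsBasisSet n (Sum.elim v y) B ∧
    ∀ j : Fin M, Sum.inr j ∈ B → (j : ℕ) < mVal n k (leftPart B)}

/-- The space `𝒫_k = ∑_{Z ⊆ X} p_{X∖Z} Π_{k(Z)}`. -/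
def Pspace (n : ℕ) {ι : Type} [Fintype ι] [DecidableEq ι] (v : ι → Fin n → ℝ)
    (k : Finset ι → ℕ) : Submodule ℝ (MvPolynomial (Fin n) ℝ) :=
  ⨆ Z : Finset ι,
    Submodule.map (LinearMap.mulLeft ℝ (pProd n v (Finset.univ \ Z)))
      (MvPolynomial.restrictTotalDegree (Fin n) ℝ (k Z))

/-- The constants `λ` are generic: each basis `B` determines a point `bp B` at which
`q_z` vanishes exactly when `z ∈ B`. -/
def Generic (n : ℕ) {ι : Type} (v : ι → Fin n → ℝ) (lam : ι → ℝ)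
    (bp : Finset ι → Fin n → ℝ) : Prop :=
  ∀ B : Finset ι, IsBasisSet n v B →
    ∀ z : ι, MvPolynomial.eval (bp B) (pLin n (v z) - MvPolynomial.C (lam z)) = 0 ↔ z ∈ B

/-- `x` is placable in `𝔹'`. -/
def Placable {ι : Type} [DecidableEq ι] (x : ι) (𝔹' : Set (Finset ι)) : Prop :=
  ∀ B ∈ 𝔹', ∃ a ∈ B, (insert x B).erase a ∈ 𝔹'

/-- `𝔹'` is placible. -/
inductive Placible {ι : Type} [DecidableEq ι] : Set (Finset ι) → Prop
  | singleton (B : Finset ι) : Placible {B}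
  | split (𝔹' : Set (Finset ι)) (x : ι) (hx : Placable x 𝔹')
      (hne1 : {B ∈ 𝔹' | x ∈ B}.Nonempty) (hne2 : {B ∈ 𝔹' | x ∉ B}.Nonempty)
      (hp1 : Placible {B ∈ 𝔹' | x ∈ B}) (hp2 : Placible {B ∈ 𝔹' | x ∉ B}) :
      Placible 𝔹'

/-- `X(I)` : the elements of `X ∖ I` not in the span of the earlier elements of `I`. -/
def XsetI (n : ℕ) {ι : Type} [Fintype ι] [DecidableEq ι] [LinearOrder ι]
    (v : ι → Fin n → ℝ) (I : Finset ι) : Finset ι := by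
  classical
  exact Finset.univ.filter fun x =>
    x ∉ I ∧ v x ∉ Submodule.span ℝ (v '' {b | b ∈ I ∧ b < x})

/-- `X'(B)` for `B ⊆ X ∪ Y`, with the order on `X ∪ Y` putting `X` (with its own order)
before `Y` (ordered as given). -/
def XprimeB (n : ℕ) {ι : Type} [Fintype ι] [DecidableEq ι] [LinearOrder ι] {M : ℕ}
    (v : ι → Fin n → ℝ) (y : Fin M → Fin n → ℝ) (B : Finset (ι ⊕ Fin M)) :
    Finset (ι ⊕ Fin M) := by
  classical
  exact Finset.univ.filter fun z =>
    z ∉ B ∧ Sum.elim v y z ∉ Submodule.span ℝ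
      (Sum.elim v y '' {b | b ∈ B ∧ Sum.Lex (· < ·) (· < ·) b z})

/-- The least space `Π(Θ)`. -/
def leastSpace (n : ℕ) (Θ : Finset (Fin n → ℝ)) : Submodule ℝ (MvPolynomial (Fin n) ℝ) :=
  Submodule.span ℝ
    {f | ∃ (c : (Fin n → ℝ) → ℝ) (J : ℕ),
      f = (Nat.factorial J : ℝ)⁻¹ • ∑ θ ∈ Θ, c θ • pLin n θ ^ J ∧ f ≠ 0 ∧
      ∀ j < J, ∑ θ ∈ Θ, c θ • pLin n θ ^ j = 0}

/-- The central space `𝒫(X)`, spanned by the `p_Z` over short `Z`. -/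
def centralP (n : ℕ) {ι : Type} [Fintype ι] [DecidableEq ι] (v : ι → Fin n → ℝ) :
    Submodule ℝ (MvPolynomial (Fin n) ℝ) :=
  Submodule.span ℝ
    {p | ∃ Z : Finset ι, Submodule.span ℝ (v '' ↑(Finset.univ \ Z)) = ⊤ ∧ p = pProd n v Z}

end

set_option linter.unusedSectionVars false

open Finset

section helpers

variable {n : ℕ} {κ : Type} [DecidableEq κ] {w : κ → Fin n → ℝ}

theorem aux_mono {S T : Finset κ} (h : S ⊆ T) :
    Submodule.span ℝ (w '' (S : Set κ)) ≤ Submodule.span ℝ (w '' (T : Set κ)) :=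
  Submodule.span_mono (Set.image_mono (by exact_mod_cast h))

theorem aux_card_le {A : Finset κ} (hA : LinearIndepOn ℝ w (A : Set κ)) : A.card ≤ n := by
  have h := LinearIndependent.fintype_card_le_finrank hA
  simpa using h

theorem aux_basis_of_indep {B : Finset κ} (h : LinearIndepOn ℝ w (B : Set κ)) (hc : B.card = n) :
    IsBasisSet n w B := by
  refine ⟨h, ?_⟩
  have := LinearIndependent.span_eq_top_of_card_eq_finrank' h (by simpa using hc)
  rw [← this, Set.image_eq_range]

theorem aux_basis_of_span {B : Finset κ} (h : Submodule.span ℝ (w '' (B : Set κ)) = ⊤)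
    (hc : B.card = n) : IsBasisSet n w B := by
  refine ⟨?_, h⟩
  have h' : ⊤ ≤ Submodule.span ℝ (Set.range (fun b : B => w b)) := by
    rw [← h, Set.image_eq_range]; exact le_rfl
  exact linearIndependent_of_top_le_span_of_card_eq_finrank h' (by simpa using hc)

theorem aux_basis_card {B : Finset κ} (h : IsBasisSet n w B) : B.card = n := by
  refine le_antisymm (aux_card_le h.1) ?_
  have h1 := finrank_span_finset_le_card (R := ℝ) (B.image w)
  rw [Finset.coe_image, Set.finrank, h.2] at h1
  simp at h1
  exact h1.trans Finset.card_image_le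

theorem aux_indep_insert {A : Finset κ} {x : κ} (hA : LinearIndepOn ℝ w (A : Set κ))
    (hx : w x ∉ Submodule.span ℝ (w '' (A : Set κ))) :
    LinearIndepOn ℝ w ((insert x A : Finset κ) : Set κ) := by
  have hxA : x ∉ (A : Set κ) := fun h => hx (Submodule.subset_span ⟨x, h, rfl⟩)
  rw [Finset.coe_insert, linearIndepOn_insert hxA]
  exact ⟨hA, hx⟩

theorem aux_notMem_span {A : Finset κ} {x : κ} (hxA : x ∉ A)
    (hA : LinearIndepOn ℝ w ((insert x A : Finset κ) : Set κ)) :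
    w x ∉ Submodule.span ℝ (w '' (A : Set κ)) := by
  rw [Finset.coe_insert, linearIndepOn_insert (by simpa using hxA)] at hA
  exact hA.2

theorem aux_exchange (A D : Finset κ) (x : κ) (hAD : Disjoint A D)
    (hx : w x ∈ Submodule.span ℝ (w '' ((A ∪ D : Finset κ) : Set κ)))
    (hxA : w x ∉ Submodule.span ℝ (w '' (A : Set κ))) :
    ∃ i ∈ D, w i ∈ Submodule.span ℝ (w '' ((insert x ((A ∪ D).erase i) : Finset κ) : Set κ)) := by
  induction D using Finset.induction_on with
  | empty => simp at hx; exact absurd hx hxA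
  | insert d D hd ih =>
    rw [Finset.disjoint_insert_right] at hAD
    by_cases h : w x ∈ Submodule.span ℝ (w '' ((A ∪ D : Finset κ) : Set κ))
    · obtain ⟨i, hi, h2⟩ := ih hAD.2 h
      refine ⟨i, by simp [hi], aux_mono ?_ h2⟩
      intro z; simp only [Finset.mem_insert, Finset.mem_erase, Finset.mem_union]; tauto
    · refine ⟨d, by simp, ?_⟩
      have : w d ∈ Submodule.span ℝ (insert (w x) (w '' ((A ∪ D : Finset κ) : Set κ))) := by
        apply mem_span_insert_exchange _ h
        rw [← Set.image_insert_eq, ← Finset.coe_insert]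
        refine aux_mono ?_ hx
        intro z; simp only [Finset.mem_insert, Finset.mem_union]; tauto
      rw [← Set.image_insert_eq, ← Finset.coe_insert] at this
      refine aux_mono ?_ this
      intro z; simp only [Finset.mem_insert, Finset.mem_erase, Finset.mem_union]
      rintro (h | h | h)
      · tauto
      · right; refine ⟨?_, Or.inl h⟩; rintro rfl; exact hAD.1 h
      · right; refine ⟨?_, by tauto⟩; rintro rfl; exact hd h

theorem aux_perp (S : Finset κ) (x : κ) (hx : w x ∉ Submodule.span ℝ (w '' (S : Set κ))) :
    ∃ μ : Fin n → ℝ, (∀ a ∈ S, w a ⬝ᵥ μ = 0) ∧ w x ⬝ᵥ μ = 1 := by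
  obtain ⟨φ, h1, h2⟩ := Submodule.exists_le_ker_of_notMem hx
  have key : ∀ u : Fin n → ℝ, u ⬝ᵥ (fun i => φ (Pi.single i 1)) = φ u := by
    intro u
    conv_rhs => rw [pi_eq_sum_univ' u]
    simp [dotProduct, map_sum]
  refine ⟨(φ (w x))⁻¹ • (fun i => φ (Pi.single i 1)), ?_, ?_⟩
  · intro a ha
    rw [dotProduct_smul, key]
    have : φ (w a) = 0 := h2 (Submodule.subset_span ⟨a, ha, rfl⟩)
    simp [this]
  · rw [dotProduct_smul, key]; simp [h1]

theorem aux_perp_span {S : Finset κ} {x : κ} (hx : w x ∈ Submodule.span ℝ (w '' (S : Set κ)))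
    {η : Fin n → ℝ} (h : ∀ a ∈ S, w a ⬝ᵥ η = 0) : w x ⬝ᵥ η = 0 := by
  generalize w x = u at hx
  induction hx using Submodule.span_induction with
  | mem u hu => obtain ⟨a, ha, rfl⟩ := hu; exact h a ha
  | zero => simp
  | add u u' _ _ h1 h2 => rw [add_dotProduct, h1, h2, add_zero]
  | smul c u _ h1 => rw [smul_dotProduct, h1, smul_zero]

theorem aux_perp_basis {B : Finset κ} (hB : IsBasisSet n w B)
    {η : Fin n → ℝ} (h : ∀ a ∈ B, w a ⬝ᵥ η = 0) : η = 0 := by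
  have : ∀ u : Fin n → ℝ, u ⬝ᵥ η = 0 := by
    intro u
    have hu : u ∈ Submodule.span ℝ (w '' (B : Set κ)) := by rw [hB.2]; trivial
    induction hu using Submodule.span_induction with
    | mem u hu => obtain ⟨a, ha, rfl⟩ := hu; exact h a ha
    | zero => simp
    | add u u' _ _ h1 h2 => rw [add_dotProduct, h1, h2, add_zero]
    | smul c u _ h1 => rw [smul_dotProduct, h1, smul_zero]
  exact dotProduct_self_eq_zero.mp (this η)

theorem aux_eval_pLin (x t : Fin n → ℝ) : MvPolynomial.eval t (pLin n x) = x ⬝ᵥ t := by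
  simp [pLin, dotProduct]

theorem aux_pLin_linear (u : Fin n → ℝ) {S : Set (Fin n → ℝ)} (hu : u ∈ Submodule.span ℝ S)
    (I : Ideal (MvPolynomial (Fin n) ℝ)) (h : ∀ s ∈ S, pLin n s ∈ I) : pLin n u ∈ I := by
  induction hu using Submodule.span_induction with
  | mem u hu => exact h u hu
  | zero => simp [pLin]
  | add u u' _ _ h1 h2 =>
    have : pLin n (u + u') = pLin n u + pLin n u' := by
      simp [pLin, add_mul, Finset.sum_add_distrib]
    rw [this]; exact I.add_mem h1 h2
  | smul c u _ h1 =>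
    have : pLin n (c • u) = MvPolynomial.C c * pLin n u := by
      simp [pLin, Finset.mul_sum, mul_assoc]
    rw [this]; exact I.mul_mem_left _ h1

/-- existence of generic constants -/
theorem aux_generic [Fintype κ] (w : κ → Fin n → ℝ) : ∃ (lam : κ → ℝ) (θ : Finset κ → Fin n → ℝ),
    ∀ B, IsBasisSet n w B → (∀ b ∈ B, w b ⬝ᵥ θ B = lam b) ∧ ∀ z, z ∉ B → w z ⬝ᵥ θ B ≠ lam z := by
  classical
  have hT : ∀ B : Finset κ, ∃ T : (κ → ℝ) →ₗ[ℝ] (Fin n → ℝ), IsBasisSet n w B →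
      ∀ lam, ∀ b ∈ B, w b ⬝ᵥ T lam = lam b := by
    intro B
    by_cases hB : IsBasisSet n w B
    swap
    · exact ⟨0, fun h => absurd h hB⟩
    let E : (Fin n → ℝ) →ₗ[ℝ] (B → ℝ) := LinearMap.pi fun b =>
      { toFun := fun t => w b ⬝ᵥ t
        map_add' := fun a c => dotProduct_add _ _ _
        map_smul' := fun a c => dotProduct_smul _ _ _ }
    have hE : Function.Injective E := by
      rw [injective_iff_map_eq_zero]
      intro t ht
      refine aux_perp_basis hB fun a ha => ?_
      exact congrFun ht ⟨a, ha⟩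
    have hf : Module.finrank ℝ (Fin n → ℝ) = Module.finrank ℝ (B → ℝ) := by
      simp [aux_basis_card hB]
    let e := LinearMap.linearEquivOfInjective E hE hf
    refine ⟨e.symm.toLinearMap ∘ₗ (LinearMap.pi fun b : B => LinearMap.proj (b : κ)), fun _ lam b hb => ?_⟩
    have h1 : E (e.symm (fun b : B => lam b)) = fun b : B => lam b := by
      have := LinearMap.linearEquivOfInjective_apply (f := E) (hf := hE) (hdim := hf)
        (x := e.symm (fun b : B => lam b))
      rw [← this]
      exact e.apply_symm_apply _
    exact congrFun h1 ⟨b, hb⟩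
  choose T hT using hT
  let U : Finset κ × κ → Submodule ℝ (κ → ℝ) := fun Bz => LinearMap.ker
    ({ toFun := fun lam => w Bz.2 ⬝ᵥ T Bz.1 lam - lam Bz.2
       map_add' := fun a c => by simp [dotProduct_add]; ring
       map_smul' := fun a c => by simp [dotProduct_smul]; ring } : (κ → ℝ) →ₗ[ℝ] ℝ)
  let s : Finset (Submodule ℝ (κ → ℝ)) :=
    (Finset.univ.filter fun Bz : Finset κ × κ => IsBasisSet n w Bz.1 ∧ Bz.2 ∉ Bz.1).image U
  have hs : ⊤ ∉ s := by
    intro h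
    obtain ⟨⟨B, z⟩, h1, h2⟩ := Finset.mem_image.mp h
    simp only [Finset.mem_filter, Finset.mem_univ, true_and] at h1
    have h3 : (Pi.single z 1 : κ → ℝ) ∈ U (B, z) := by rw [h2]; trivial
    have h4 : w z ⬝ᵥ T B (Pi.single z 1) - (Pi.single z 1 : κ → ℝ) z = 0 := h3
    have h5 : T B (Pi.single z 1) = 0 := by
      refine aux_perp_basis h1.1 fun a ha => ?_
      rw [hT B h1.1 _ a ha]
      refine Pi.single_eq_of_ne ?_ _
      rintro rfl; exact h1.2 ha
    rw [h5] at h4; simp at h4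
  have h := Subspace.biUnion_ne_univ_of_top_notMem hs
  obtain ⟨lam, hl⟩ := (Set.ne_univ_iff_exists_notMem _).mp h
  refine ⟨lam, fun B => T B lam, fun B hB => ⟨hT B hB lam, fun z hz h' => hl ?_⟩⟩
  simp only [Set.mem_iUnion]
  refine ⟨U (B, z), Finset.mem_image.mpr ⟨(B, z), by simp [hB, hz], rfl⟩, ?_⟩
  show w z ⬝ᵥ T B lam - lam z = 0
  rw [h', sub_self]


theorem aux_Jmono {F G : Set (Finset κ)} (h : F ⊆ G) : Jideal n w G ≤ Jideal n w F := by
  apply Ideal.span_mono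
  rintro p ⟨Z, hZ, rfl⟩
  exact ⟨Z, fun B hB => hZ B (h hB), rfl⟩

theorem aux_Jmem {F : Set (Finset κ)} (Z : Finset κ) (h : ∀ B ∈ F, (Z ∩ B).Nonempty) :
    pProd n w Z ∈ Jideal n w F := Ideal.subset_span ⟨Z, h, rfl⟩

theorem aux_split {F : Set (Finset κ)} {x : κ}
    (hx : ∀ B ∈ F, x ∉ B → ∃ a ∈ B, insert x (B.erase a) ∈ F)
    {P P1 P2 : Submodule ℝ (MvPolynomial (Fin n) ℝ)}
    (h1 : (Jideal n w {B ∈ F | x ∈ B}).restrictScalars ℝ ⊔ P1 = ⊤)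
    (h2 : (Jideal n w {B ∈ F | x ∉ B}).restrictScalars ℝ ⊔ P2 = ⊤)
    (hP1 : P1 ≤ P) (hP2 : ∀ p ∈ P2, pLin n (w x) * p ∈ P) :
    (Jideal n w F).restrictScalars ℝ ⊔ P = ⊤ := by
  have hJ1 : Jideal n w {B ∈ F | x ∈ B} ≤ Jideal n w F ⊔ Ideal.span {pLin n (w x)} := by
    apply Ideal.span_le.mpr
    rintro p ⟨Z, hZ, rfl⟩
    by_cases hxZ : x ∈ Z
    · refine Ideal.mem_sup_right ?_
      rw [Ideal.mem_span_singleton]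
      exact Finset.dvd_prod_of_mem (fun a => pLin n (w a)) hxZ
    · refine Ideal.mem_sup_left (aux_Jmem Z fun B hB => ?_)
      by_cases hxB : x ∈ B
      · exact hZ B ⟨hB, hxB⟩
      · obtain ⟨a, ha, h⟩ := hx B hB hxB
        obtain ⟨z, hz⟩ := hZ _ ⟨h, by simp⟩
        simp only [Finset.mem_inter, Finset.mem_insert, Finset.mem_erase] at hz
        rcases hz with ⟨hz, rfl | hz'⟩
        · exact absurd hz hxZ
        · exact ⟨z, by simp [hz, hz'.2]⟩
  have hJ2 : ∀ j ∈ Jideal n w {B ∈ F | x ∉ B}, pLin n (w x) * j ∈ Jideal n w F := by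
    intro j hj
    induction hj using Submodule.span_induction with
    | mem p hp =>
      obtain ⟨Z, hZ, rfl⟩ := hp
      have : pProd n w (insert x Z) ∈ Jideal n w F := by
        refine aux_Jmem _ fun B hB => ?_
        by_cases hxB : x ∈ B
        · exact ⟨x, by simp [hxB]⟩
        · obtain ⟨z, hz⟩ := hZ B ⟨hB, hxB⟩
          rw [Finset.mem_inter] at hz
          exact ⟨z, by simp [hz.1, hz.2]⟩
      by_cases hxZ : x ∈ Z
      · rw [Finset.insert_eq_of_mem hxZ] at this
        exact Ideal.mul_mem_left _ _ this
      · unfold pProd at this ⊢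
        rwa [Finset.prod_insert hxZ] at this
    | zero => simp
    | add a b _ _ ha hb => rw [mul_add]; exact Ideal.add_mem _ ha hb
    | smul c a _ ha => rw [smul_eq_mul, mul_left_comm]; exact Ideal.mul_mem_left _ _ ha
  rw [eq_top_iff]
  intro f _
  have hf : f ∈ (Jideal n w {B ∈ F | x ∈ B}).restrictScalars ℝ ⊔ P1 := by rw [h1]; trivial
  obtain ⟨j, hj, p, hp, rfl⟩ := Submodule.mem_sup.mp hf
  obtain ⟨j', hj', q, hq, rfl⟩ := Submodule.mem_sup.mp (hJ1 hj)
  obtain ⟨h, rfl⟩ := Ideal.mem_span_singleton.mp hq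
  have hh : h ∈ (Jideal n w {B ∈ F | x ∉ B}).restrictScalars ℝ ⊔ P2 := by rw [h2]; trivial
  obtain ⟨j2, hj2, p2, hp2, rfl⟩ := Submodule.mem_sup.mp hh
  refine Submodule.add_mem _ (Submodule.add_mem _ (Submodule.mem_sup_left hj') ?_)
    (Submodule.mem_sup_right (hP1 hp))
  rw [mul_add]
  exact Submodule.add_mem _ (Submodule.mem_sup_left (hJ2 _ hj2)) (Submodule.mem_sup_right (hP2 _ hp2))

theorem aux_single {B : Finset κ} (hB : IsBasisSet n w B) (c : ℕ) :
    (Jideal n w {B}).restrictScalars ℝ ⊔ restrictTotalDegree (Fin n) ℝ c = ⊤ := by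
  have hlin : ∀ u, pLin n u ∈ Jideal n w {B} := by
    intro u
    have hu : u ∈ Submodule.span ℝ (w '' (B : Set κ)) := by rw [hB.2]; trivial
    refine aux_pLin_linear u hu _ ?_
    rintro _ ⟨b, hb, rfl⟩
    have := aux_Jmem (n := n) (w := w) (F := {B}) {b} (by
      rintro B' rfl; exact ⟨b, by simpa using hb⟩)
    simpa [pProd] using this
  have hX : ∀ i, (X i : MvPolynomial (Fin n) ℝ) ∈ Jideal n w {B} := by
    intro i
    have := hlin (Pi.single i 1)
    simpa [pLin, Pi.single_apply] using this
  rw [eq_top_iff]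
  intro f _
  induction f using MvPolynomial.induction_on with
  | C a =>
    refine Submodule.mem_sup_right ?_
    rw [mem_restrictTotalDegree]; simp
  | add p q hp hq => exact Submodule.add_mem _ (hp trivial) (hq trivial)
  | mul_X p i _ => exact Submodule.mem_sup_left (Ideal.mul_mem_left _ _ (hX i))

def famY (n : ℕ) (A W : Finset κ) : Set (Finset κ) := {B | A ⊆ B ∧ B ⊆ A ∪ W ∧ B.card = n}

/-- extension of independent sets by elements in general position -/
def GPset (n : ℕ) (w : κ → Fin n → ℝ) (y : κ) : Prop :=
  ∀ S : Finset κ, y ∉ S → S.card < n → w y ∉ Submodule.span ℝ (w '' (S : Set κ))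

theorem aux_ext {A W : Finset κ} (hA : LinearIndepOn ℝ w (A : Set κ)) (hW : ∀ y ∈ W, GPset n w y)
    (hc : (A ∪ W).card ≤ n) : LinearIndepOn ℝ w ((A ∪ W : Finset κ) : Set κ) := by
  induction W using Finset.induction_on with
  | empty => simpa using hA
  | insert y W hy ih =>
    by_cases hyA : y ∈ A ∪ W
    · have h : A ∪ insert y W = A ∪ W := by
        rw [Finset.union_insert, Finset.insert_eq_of_mem hyA]
      rw [h] at hc ⊢
      exact ih (fun z hz => hW z (by simp [hz])) hc
    · rw [Finset.union_insert] at hc ⊢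
      rw [Finset.card_insert_of_notMem hyA] at hc
      exact aux_indep_insert (ih (fun z hz => hW z (by simp [hz])) (by omega))
        (hW y (by simp) _ hyA (by omega))

theorem aux_famY_basis {A W B : Finset κ} (hA : LinearIndepOn ℝ w (A : Set κ))
    (hW : ∀ y ∈ W, GPset n w y) (hB : B ∈ famY n A W) : IsBasisSet n w B := by
  obtain ⟨h1, h2, h3⟩ := hB
  have h : A ∪ (B \ A) = B := Finset.union_sdiff_of_subset h1
  refine aux_basis_of_indep ?_ h3
  rw [← h]
  refine aux_ext hA (fun y hy => hW y ?_) (by rw [h, h3])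
  simp only [Finset.mem_sdiff] at hy
  have := h2 hy.1
  simp only [Finset.mem_union] at this; tauto

theorem aux_pLin_deg (u : Fin n → ℝ) : (pLin n u).totalDegree ≤ 1 := by
  refine (totalDegree_finsetSum _ _).trans (Finset.sup_le fun i _ => ?_)
  refine (totalDegree_mul _ _).trans ?_
  simp

theorem aux_baseJ (W : Finset κ) : ∀ (A : Finset κ) (c : ℕ), LinearIndepOn ℝ w (A : Set κ) →
    Disjoint A W → (∀ y ∈ W, GPset n w y) → W.card + A.card = c + n →
    (Jideal n w (famY n A W)).restrictScalars ℝ ⊔ restrictTotalDegree (Fin n) ℝ c = ⊤ := by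
  induction W using Finset.induction_on with
  | empty =>
    intro A c hA _ hW hc
    have h1 := aux_card_le hA
    simp only [Finset.card_empty, zero_add] at hc
    have : famY n A ∅ = {A} := by
      ext B
      simp only [famY, Finset.union_empty, Set.mem_ofPred_eq, Set.mem_singleton_iff]
      constructor
      · rintro ⟨a, b, _⟩; exact Finset.Subset.antisymm b a
      · rintro rfl; exact ⟨subset_rfl, subset_rfl, by omega⟩
    rw [this]
    exact aux_single (aux_basis_of_indep hA (by omega)) c
  | insert y W hy ih =>
    intro A c hA hAW hW hc
    rw [Finset.disjoint_insert_right] at hAW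
    rw [Finset.card_insert_of_notMem hy] at hc
    by_cases hAn : A.card = n
    · have : famY n A (insert y W) = {A} := by
        ext B
        simp only [famY, Set.mem_ofPred_eq, Set.mem_singleton_iff]
        constructor
        · rintro ⟨a, b, h⟩; exact (Finset.eq_of_subset_of_card_le a (by omega)).symm
        · rintro rfl; exact ⟨subset_rfl, Finset.subset_union_left, by omega⟩
      rw [this]
      exact aux_single (aux_basis_of_indep hA hAn) c
    have hlt : A.card < n := lt_of_le_of_ne (aux_card_le hA) hAn
    rcases c with _ | c
    · have : famY n A (insert y W) = {A ∪ insert y W} := by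
        have hcard : (A ∪ insert y W).card = n := by
          rw [Finset.card_union_of_disjoint (by rw [Finset.disjoint_insert_right]; exact hAW),
            Finset.card_insert_of_notMem hy]; omega
        ext B
        simp only [famY, Set.mem_ofPred_eq, Set.mem_singleton_iff]
        constructor
        · rintro ⟨a, b, h⟩; exact Finset.eq_of_subset_of_card_le b (by omega)
        · rintro rfl; exact ⟨Finset.subset_union_left, subset_rfl, hcard⟩
      rw [this]
      refine aux_single (aux_famY_basis (A := A) (W := insert y W) hA hW ?_) 0
      rw [this]; rfl
    have hyA := hW y (by simp) A hAW.1 hlt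
    have i1 := ih (insert y A) (c + 1) (aux_indep_insert hA hyA)
      (by rw [Finset.disjoint_insert_left]; exact ⟨hy, hAW.2⟩) (fun z hz => hW z (by simp [hz]))
      (by rw [Finset.card_insert_of_notMem hAW.1]; omega)
    have i2 := ih A c hA hAW.2 (fun z hz => hW z (by simp [hz])) (by omega)
    have e1 : {B ∈ famY n A (insert y W) | y ∈ B} = famY n (insert y A) W := by
      ext B
      simp only [famY, Set.mem_ofPred_eq, Finset.insert_subset_iff, Finset.insert_union,
        Finset.union_insert]
      tauto
    have e2 : {B ∈ famY n A (insert y W) | y ∉ B} = famY n A W := by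
      ext B
      simp only [famY, Set.mem_ofPred_eq, Finset.union_insert]
      constructor
      · rintro ⟨⟨a, b, h⟩, h'⟩
        exact ⟨a, (Finset.subset_insert_iff_of_notMem h').mp b, h⟩
      · rintro ⟨a, b, h⟩
        refine ⟨⟨a, b.trans (Finset.subset_insert _ _), h⟩, fun h' => ?_⟩
        have := b h'
        simp only [Finset.mem_union] at this
        tauto
    rw [← e1] at i1
    rw [← e2] at i2
    refine aux_split ?_ i1 i2 le_rfl ?_
    · rintro B ⟨a, b, h⟩ hyB
      obtain ⟨z, hz, hzA⟩ := Finset.exists_mem_notMem_of_card_lt_card (s := A) (t := B) (by omega)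
      refine ⟨z, hz, ?_, ?_, ?_⟩
      · intro q hq
        simp only [Finset.mem_insert, Finset.mem_erase]
        right; exact ⟨fun h => hzA (h ▸ hq), a hq⟩
      · intro q hq
        simp only [Finset.mem_insert, Finset.mem_erase] at hq
        rcases hq with rfl | hq
        · simp
        · exact b hq.2
      · rw [Finset.card_insert_of_notMem (by simp [hyB]), Finset.card_erase_of_mem hz]; omega
    · intro p hp
      rw [mem_restrictTotalDegree] at hp ⊢
      have := totalDegree_mul (pLin n (w y)) p
      have := aux_pLin_deg (w y)
      omega


noncomputable def lineP (f : MvPolynomial (Fin n) ℝ) (t η : Fin n → ℝ) : Polynomial ℝ :=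
  MvPolynomial.aeval (fun i => Polynomial.C (t i) + Polynomial.C (η i) * Polynomial.X) f

theorem lineP_eval (f : MvPolynomial (Fin n) ℝ) (t η : Fin n → ℝ) (s : ℝ) :
    (lineP f t η).eval s = MvPolynomial.eval (t + s • η) f := by
  induction f using MvPolynomial.induction_on with
  | C a => simp [lineP]
  | add p q hp hq => simp only [lineP, map_add, Polynomial.eval_add] at *; rw [hp, hq]
  | mul_X p i hp =>
    simp only [lineP, map_mul, Polynomial.eval_mul, aeval_X] at *
    rw [hp]; simp only [Polynomial.eval_add, Polynomial.eval_C, Polynomial.eval_mul, Polynomial.eval_X, eval_X, Pi.add_apply, Pi.smul_apply, smul_eq_mul]; ring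

theorem lineP_pLin (x t η : Fin n → ℝ) :
    lineP (pLin n x) t η = Polynomial.C (x ⬝ᵥ t) + Polynomial.C (x ⬝ᵥ η) * Polynomial.X := by
  apply Polynomial.funext
  intro s
  rw [lineP_eval, aux_eval_pLin, dotProduct_add, dotProduct_smul]
  simp only [Polynomial.eval_add, Polynomial.eval_C, Polynomial.eval_mul, Polynomial.eval_X, smul_eq_mul]; ring

theorem lineP_coeff_cont (f : MvPolynomial (Fin n) ℝ) (t η : ℝ → Fin n → ℝ) (ht : Continuous t)
    (hη : Continuous η) : ∀ j : ℕ, Continuous fun ε => (lineP f (t ε) (η ε)).coeff j := by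
  induction f using MvPolynomial.induction_on with
  | C a => intro j; simp [lineP]; exact continuous_const
  | add p q hp hq =>
    intro j
    simp only [lineP, map_add, Polynomial.coeff_add] at *
    exact (hp j).add (hq j)
  | mul_X p i hp =>
    intro j
    have h1 : Continuous fun ε => t ε i := (continuous_apply i).comp ht
    have h2 : Continuous fun ε => η ε i := (continuous_apply i).comp hη
    simp only [lineP, map_mul, aeval_X, mul_add, Polynomial.coeff_add, Polynomial.coeff_mul_C,
      ← mul_assoc] at *
    rcases j with _ | j
    · simp only [Polynomial.mul_coeff_zero, Polynomial.coeff_X_zero, mul_zero, add_zero]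
      exact (hp 0).mul h1
    · simp only [Polynomial.coeff_mul_X, Polynomial.coeff_mul_C]
      exact ((hp _).mul h1).add ((hp _).mul h2)

theorem lineP_limit (f : MvPolynomial (Fin n) ℝ) (t η : ℝ → Fin n → ℝ) (ht : Continuous t)
    (hη : Continuous η) (e : ℝ) (N : ℕ) (h : ∀ ε, ε ≠ e → (lineP f (t ε) (η ε)).natDegree ≤ N)
    (ε : ℝ) : (lineP f (t ε) (η ε)).natDegree ≤ N := by
  rw [Polynomial.natDegree_le_iff_coeff_eq_zero]
  intro j hj
  have := Continuous.ext_on (dense_compl_singleton e) (lineP_coeff_cont f t η ht hη j)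
    (continuous_const (y := (0 : ℝ))) (fun ε hε =>
      Polynomial.natDegree_le_iff_coeff_eq_zero.mp (h ε hε) j hj)
  exact congrFun this ε

/-- affine flat -/
def LA (w : κ → Fin n → ℝ) (lam : κ → ℝ) (A : Finset κ) : Set (Fin n → ℝ) :=
  {t | ∀ a ∈ A, w a ⬝ᵥ t = lam a}

variable {lam : κ → ℝ}

theorem aux_div {A : Finset κ} {x : κ} (hx : w x ∉ Submodule.span ℝ (w '' (A : Set κ)))
    (f : MvPolynomial (Fin n) ℝ) (hf : ∀ t ∈ LA w lam (insert x A), MvPolynomial.eval t f = 0) :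
    ∃ g : MvPolynomial (Fin n) ℝ, ∀ t ∈ LA w lam A,
      MvPolynomial.eval t f = (w x ⬝ᵥ t - lam x) * MvPolynomial.eval t g := by
  obtain ⟨μ, h1, h2⟩ := aux_perp A x hx
  set l : MvPolynomial (Fin n) ℝ := pLin n (w x) - C (lam x) with hl
  let F : MvPolynomial (Fin n) ℝ →ₐ[ℝ] MvPolynomial (Fin n) ℝ :=
    MvPolynomial.aeval (fun i => X i - l * C (μ i))
  have hcomp : (Ideal.Quotient.mkₐ ℝ (Ideal.span {l})).comp F = Ideal.Quotient.mkₐ ℝ (Ideal.span {l}) := by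
    apply MvPolynomial.algHom_ext
    intro i
    simp only [F, AlgHom.comp_apply, aeval_X, Ideal.Quotient.mkₐ_eq_mk]
    rw [Ideal.Quotient.eq, Ideal.mem_span_singleton]
    exact ⟨-C (μ i), by ring⟩
  have hd : f - F f ∈ Ideal.span {l} := by
    have := DFunLike.congr_fun hcomp f
    simp only [AlgHom.comp_apply, Ideal.Quotient.mkₐ_eq_mk] at this
    rw [← Ideal.Quotient.eq]; exact this.symm
  obtain ⟨g, hg⟩ := Ideal.mem_span_singleton.mp hd
  refine ⟨g, fun t ht => ?_⟩
  have e1 : MvPolynomial.eval t (F f) = MvPolynomial.eval (t - (w x ⬝ᵥ t - lam x) • μ) f := by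
    have : (MvPolynomial.aeval t : MvPolynomial (Fin n) ℝ →ₐ[ℝ] ℝ).comp F =
        MvPolynomial.aeval (t - (w x ⬝ᵥ t - lam x) • μ) := by
      apply MvPolynomial.algHom_ext
      intro i
      simp only [F, AlgHom.comp_apply, aeval_X]
      simp [hl, aux_eval_pLin, MvPolynomial.aeval_eq_eval]
    have := DFunLike.congr_fun this f
    simpa [MvPolynomial.aeval_eq_eval] using this
  have e2 : MvPolynomial.eval (t - (w x ⬝ᵥ t - lam x) • μ) f = 0 := by
    apply hf
    intro a ha
    rw [dotProduct_sub, dotProduct_smul]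
    rcases Finset.mem_insert.mp ha with rfl | ha
    · rw [h2]; simp
    · rw [h1 a ha, ht a ha]; simp
  have := congrArg (MvPolynomial.eval t) hg
  rw [map_sub, e1, e2, map_mul, hl, map_sub, aux_eval_pLin, eval_C, sub_zero] at this
  exact this

theorem aux_lineP_mul {A : Finset κ} {x : κ} {f g : MvPolynomial (Fin n) ℝ}
    (hg : ∀ t ∈ LA w lam A, MvPolynomial.eval t f = (w x ⬝ᵥ t - lam x) * MvPolynomial.eval t g)
    {t η : Fin n → ℝ} (ht : t ∈ LA w lam A) (hη : ∀ a ∈ A, w a ⬝ᵥ η = 0) :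
    lineP f t η = (Polynomial.C (w x ⬝ᵥ η) * Polynomial.X + Polynomial.C (w x ⬝ᵥ t - lam x)) *
      lineP g t η := by
  apply Polynomial.funext
  intro s
  rw [Polynomial.eval_mul, lineP_eval, lineP_eval, hg]
  · simp [dotProduct_add, dotProduct_smul]; left; ring
  · intro a ha
    rw [dotProduct_add, dotProduct_smul, ht a ha, hη a ha]; simp

theorem aux_degA {A A' : Finset κ} {x : κ} {f g : MvPolynomial (Fin n) ℝ} {N : ℕ} (hAA : A ⊆ A')
    (hg : ∀ t ∈ LA w lam A, MvPolynomial.eval t f = (w x ⬝ᵥ t - lam x) * MvPolynomial.eval t g)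
    (hx : w x ∉ Submodule.span ℝ (w '' (A' : Set κ)))
    (hf : ∀ t ∈ LA w lam A, ∀ η, (∀ a ∈ A', w a ⬝ᵥ η = 0) → (lineP f t η).natDegree ≤ N + 1) :
    ∀ t ∈ LA w lam A, ∀ η, (∀ a ∈ A', w a ⬝ᵥ η = 0) → (lineP g t η).natDegree ≤ N := by
  intro t ht η hη
  obtain ⟨μ, h1, h2⟩ := aux_perp A' x hx
  have := lineP_limit g (fun _ => t) (fun ε => η + ε • μ) continuous_const (by fun_prop)
    (-(w x ⬝ᵥ η)) N ?_ 0
  · simpa using this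
  intro ε hε
  have hη' : ∀ a ∈ A', w a ⬝ᵥ (η + ε • μ) = 0 := by
    intro a ha; rw [dotProduct_add, dotProduct_smul, hη a ha, h1 a ha]; simp
  have hd := hf t ht _ hη'
  rw [aux_lineP_mul hg ht (fun a ha => hη' a (hAA ha))] at hd
  have hne : w x ⬝ᵥ (η + ε • μ) ≠ 0 := by
    rw [dotProduct_add, dotProduct_smul, h2]
    intro h; apply hε; simp at h; linarith
  by_cases hz : lineP g t (η + ε • μ) = 0
  · rw [hz]; simp
  rw [Polynomial.natDegree_mul _ hz, Polynomial.natDegree_linear hne] at hd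
  · show (lineP g t (η + ε • μ)).natDegree ≤ N
    omega
  · intro h
    have := Polynomial.natDegree_linear (b := w x ⬝ᵥ t - lam x) hne
    rw [h] at this; simp at this

theorem aux_degB {A A' : Finset κ} {x : κ} {f g : MvPolynomial (Fin n) ℝ} {N : ℕ} (hAA : A ⊆ A')
    (hg : ∀ t ∈ LA w lam A, MvPolynomial.eval t f = (w x ⬝ᵥ t - lam x) * MvPolynomial.eval t g)
    (hx : w x ∉ Submodule.span ℝ (w '' (A : Set κ)))
    (hx' : w x ∈ Submodule.span ℝ (w '' (A' : Set κ)))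
    (hf : ∀ t ∈ LA w lam A, ∀ η, (∀ a ∈ A', w a ⬝ᵥ η = 0) → (lineP f t η).natDegree ≤ N) :
    ∀ t ∈ LA w lam A, ∀ η, (∀ a ∈ A', w a ⬝ᵥ η = 0) → (lineP g t η).natDegree ≤ N := by
  intro t ht η hη
  obtain ⟨μ, h1, h2⟩ := aux_perp A x hx
  have := lineP_limit g (fun ε => t + ε • μ) (fun _ => η) (by fun_prop) continuous_const
    (lam x - w x ⬝ᵥ t) N ?_ 0
  · simpa using this
  intro ε hε
  have ht' : t + ε • μ ∈ LA w lam A := by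
    intro a ha; rw [dotProduct_add, dotProduct_smul, ht a ha, h1 a ha]; simp
  have hd := hf _ ht' η hη
  rw [aux_lineP_mul hg ht' (fun a ha => hη a (hAA ha)), aux_perp_span hx' hη] at hd
  have hne : w x ⬝ᵥ (t + ε • μ) - lam x ≠ 0 := by
    rw [dotProduct_add, dotProduct_smul, h2]
    intro h; apply hε; simp at h; linarith
  rw [Polynomial.C_0, zero_mul, zero_add, Polynomial.natDegree_C_mul hne] at hd
  exact hd

theorem aux_basePts {θ : Finset κ → Fin n → ℝ}
    (hθ : ∀ B, IsBasisSet n w B → (∀ b ∈ B, w b ⬝ᵥ θ B = lam b) ∧ ∀ z, z ∉ B → w z ⬝ᵥ θ B ≠ lam z)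
    (W : Finset κ) : ∀ (A : Finset κ) (c : ℕ), LinearIndepOn ℝ w (A : Set κ) →
    Disjoint A W → (∀ y ∈ W, GPset n w y) → W.card + A.card = c + n →
    ∀ f : MvPolynomial (Fin n) ℝ,
    (∀ t ∈ LA w lam A, ∀ η, (∀ a ∈ A, w a ⬝ᵥ η = 0) → (lineP f t η).natDegree ≤ c) →
    (∀ B ∈ famY n A W, MvPolynomial.eval (θ B) f = 0) →
    ∀ t ∈ LA w lam A, MvPolynomial.eval t f = 0 := by
  have full : ∀ A : Finset κ, LinearIndepOn ℝ w (A : Set κ) → A.card = n → 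
      ∀ t ∈ LA w lam A, t = θ A := by
    intro A hA hAn t ht
    have hB := aux_basis_of_indep hA hAn
    have := aux_perp_basis hB (η := t - θ A) (fun a ha => by
      rw [dotProduct_sub, ht a ha, (hθ A hB).1 a ha, sub_self])
    exact sub_eq_zero.mp this
  induction W using Finset.induction_on with
  | empty =>
    intro A c hA _ hW hc f _ hv t ht
    have h1 := aux_card_le hA
    simp only [Finset.card_empty, zero_add] at hc
    rw [full A hA (by omega) t ht]
    exact hv A ⟨subset_rfl, by simp, by omega⟩
  | insert y W hy ih =>
    intro A c hA hAW hW hc f hdeg hv t ht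
    rw [Finset.disjoint_insert_right] at hAW
    rw [Finset.card_insert_of_notMem hy] at hc
    by_cases hAn : A.card = n
    · rw [full A hA hAn t ht]
      exact hv A ⟨subset_rfl, Finset.subset_union_left, hAn⟩
    have hlt : A.card < n := lt_of_le_of_ne (aux_card_le hA) hAn
    rcases c with _ | c
    · have hcard : (A ∪ insert y W).card = n := by
          rw [Finset.card_union_of_disjoint (by rw [Finset.disjoint_insert_right]; exact hAW),
            Finset.card_insert_of_notMem hy]; omega
      have hm : A ∪ insert y W ∈ famY n A (insert y W) :=
        ⟨Finset.subset_union_left, subset_rfl, hcard⟩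
      have hb := hθ _ (aux_famY_basis hA hW hm)
      have h0 := hv _ hm
      set τ := θ (A ∪ insert y W)
      have hτ : τ ∈ LA w lam A := fun a ha => hb.1 a (by simp [ha])
      have hd := hdeg τ hτ (t - τ) (fun a ha => by rw [dotProduct_sub, ht a ha, hτ a ha, sub_self])
      obtain ⟨r, hr⟩ := Polynomial.natDegree_eq_zero.mp (Nat.le_zero.mp hd)
      have e0 := lineP_eval f τ (t - τ) 0
      have e1 := lineP_eval f τ (t - τ) 1
      rw [← hr] at e0 e1
      simp only [Polynomial.eval_C, zero_smul, add_zero, one_smul, add_sub_cancel] at e0 e1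
      rw [← e1, e0, h0]
    have hyA := hW y (by simp) A hAW.1 hlt
    have i1 := ih (insert y A) (c + 1) (aux_indep_insert hA hyA)
      (by rw [Finset.disjoint_insert_left]; exact ⟨hy, hAW.2⟩) (fun z hz => hW z (by simp [hz]))
      (by rw [Finset.card_insert_of_notMem hAW.1]; omega) f
      (fun t ht η hη => hdeg t (fun a ha => ht a (by simp [ha])) η (fun a ha => hη a (by simp [ha])))
      (by
        rintro B ⟨h1, h2, h3⟩
        refine hv B ⟨(Finset.subset_insert _ _).trans h1, ?_, h3⟩
        rwa [Finset.union_insert, ← Finset.insert_union])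
    obtain ⟨g, hg⟩ := aux_div hyA f i1
    have i2 := ih A c hA hAW.2 (fun z hz => hW z (by simp [hz])) (by omega) g
      (aux_degA subset_rfl hg hyA hdeg) (by
        intro B hB
        have hb := hθ B (aux_famY_basis hA (fun z hz => hW z (by simp [hz])) hB)
        obtain ⟨h1, h2, h3⟩ := hB
        have h0 := hv B ⟨h1, h2.trans (by rw [Finset.union_insert]; exact Finset.subset_insert _ _), h3⟩
        rw [hg _ (fun a ha => hb.1 a (h1 ha))] at h0
        refine (mul_eq_zero.mp h0).resolve_left (sub_ne_zero.mpr (hb.2 y fun h => ?_))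
        have := h2 h
        simp only [Finset.mem_union] at this
        tauto)
    rw [hg t ht, i2 t ht, mul_zero]

end helpers


section main

variable {n : ℕ} {ι : Type} [Fintype ι] [DecidableEq ι] {v : ι → Fin n → ℝ} {M : ℕ}
  {y : Fin M → Fin n → ℝ} {k : Finset ι → ℕ}

theorem aux_img (A : Finset ι) :
    Sum.elim v y '' ((A.image Sum.inl : Finset (ι ⊕ Fin M)) : Set (ι ⊕ Fin M)) = v '' (A : Set ι) := by
  ext u; simp

theorem aux_gp (hgen : GeneralPosition n v y) (j : Fin M) : GPset n (Sum.elim v y) (Sum.inr j) :=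
  fun S h1 h2 => hgen j S h1 h2

theorem aux_indep_inl {A : Finset ι} (hA : LinearIndepOn ℝ v (A : Set ι)) :
    LinearIndepOn ℝ (Sum.elim v y) ((A.image Sum.inl : Finset (ι ⊕ Fin M)) : Set (ι ⊕ Fin M)) := by
  induction A using Finset.induction_on with
  | empty => simp
  | insert a A ha ih =>
    rw [Finset.image_insert]
    have hA' := hA.mono (t := (A : Set ι)) (by simp)
    refine aux_indep_insert (ih hA') ?_
    rw [aux_img]
    exact aux_notMem_span ha hA

theorem aux_indep_left {B : Finset (ι ⊕ Fin M)}
    (hB : LinearIndepOn ℝ (Sum.elim v y) (B : Set (ι ⊕ Fin M))) :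
    LinearIndepOn ℝ v ((leftPart B : Finset ι) : Set ι) := by
  have : LinearIndependent ℝ (fun b : B => Sum.elim v y b) := hB
  have h2 := this.comp (fun i : {i // i ∈ leftPart B} =>
    (⟨Sum.inl i.1, by have := i.2; simpa [leftPart] using this⟩ : B)) (by
      intro a b h; exact Subtype.ext (Sum.inl_injective (congrArg Subtype.val h)))
  exact h2

def Fam (v : ι → Fin n → ℝ) (y : Fin M → Fin n → ℝ) (k : Finset ι → ℕ) (A R : Finset ι) :
    Set (Finset (ι ⊕ Fin M)) :=
  {B | B ∈ Bk n v y k ∧ A ⊆ leftPart B ∧ leftPart B ⊆ A ∪ R}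

theorem mem_leftPart {B : Finset (ι ⊕ Fin M)} {i : ι} : i ∈ leftPart B ↔ Sum.inl i ∈ B := by
  simp [leftPart]

theorem Fam_in {A R : Finset ι} {x : ι} :
    {B ∈ Fam v y k A (insert x R) | Sum.inl x ∈ B} = Fam v y k (insert x A) R := by
  ext B
  simp only [Fam, Set.mem_ofPred_eq, ← mem_leftPart, Finset.insert_subset_iff,
    Finset.union_insert, Finset.insert_union]
  tauto

theorem Fam_out {A R : Finset ι} {x : ι} (hA : x ∉ A) (hR : x ∉ R) :
    {B ∈ Fam v y k A (insert x R) | Sum.inl x ∉ B} = Fam v y k A R := by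
  ext B
  simp only [Fam, Set.mem_ofPred_eq, ← mem_leftPart, Finset.union_insert]
  constructor
  · rintro ⟨⟨a, b, h⟩, h'⟩
    exact ⟨a, b, (Finset.subset_insert_iff_of_notMem h').mp h⟩
  · rintro ⟨a, b, h⟩
    refine ⟨⟨a, b, h.trans (Finset.subset_insert _ _)⟩, fun h' => ?_⟩
    have := h h'
    simp only [Finset.mem_union] at this
    tauto

theorem Fam_loop {A R : Finset ι} {x : ι} (hA : x ∉ A)
    (hx : v x ∈ Submodule.span ℝ (v '' (A : Set ι))) :
    Fam v y k A (insert x R) ⊆ Fam v y k A R := by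
  rintro B ⟨a, b, h⟩
  refine ⟨a, b, ?_⟩
  have hxB : x ∉ leftPart B := by
    intro hxB
    have h1 := (aux_indep_left a.1.1).mono (t := ((insert x A : Finset ι) : Set ι))
      (by exact_mod_cast Finset.insert_subset hxB b)
    exact aux_notMem_span hA h1 hx
  rw [Finset.union_insert] at h
  exact (Finset.subset_insert_iff_of_notMem hxB).mp h

theorem card_split (B : Finset (ι ⊕ Fin M)) :
    (leftPart B).image Sum.inl ∪ (rightPart B).image Sum.inr = B := by
  ext z
  rcases z with z | z <;> simp [leftPart, rightPart]

theorem Fam_base (hgen : GeneralPosition n v y)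
    (hM : ∀ I : Finset ι, (LinearIndependent ℝ fun i : I => v i) → mVal n k I ≤ M)
    {A : Finset ι} (hA : LinearIndepOn ℝ v (A : Set ι)) :
    Fam v y k A ∅ = famY n (A.image Sum.inl) ((YFin (M := M) (mVal n k A)).image Sum.inr) := by
  ext B
  constructor
  · rintro ⟨⟨h1, h2⟩, h3, h4⟩
    rw [Finset.union_empty] at h4
    have he : leftPart B = A := Finset.Subset.antisymm h4 h3
    refine ⟨?_, ?_, aux_basis_card h1⟩
    · intro z hz
      obtain ⟨i, hi, rfl⟩ := Finset.mem_image.mp hz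
      exact mem_leftPart.mp (h3 hi)
    · intro z hz
      rcases z with i | j
      · have := mem_leftPart.mpr hz
        rw [he] at this
        simp [this]
      · have := h2 j hz
        rw [he] at this
        simp [YFin, this]
  · intro hB
    have hb := aux_famY_basis (aux_indep_inl hA) (by
      intro z hz
      obtain ⟨j, _, rfl⟩ := Finset.mem_image.mp hz
      exact aux_gp hgen j) hB
    obtain ⟨h1, h2, h3⟩ := hB
    have he : leftPart B = A := by
      ext i
      rw [mem_leftPart]
      constructor
      · intro h
        have := h2 h
        simpa using this
      · intro h; exact h1 (by simp [h])
    refine ⟨⟨hb, ?_⟩, by rw [he], by rw [he]; simp⟩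
    intro j hj
    have := h2 hj
    rw [he]
    simpa [YFin] using this

theorem YFin_card {m : ℕ} (h : m ≤ M) : (YFin (M := M) m).card = m := by
  have : YFin (M := M) m = Finset.univ.filter fun j : Fin M => (j : ℕ) < m := rfl
  rw [this, Fin.card_filter_val_lt]
  omega

theorem Fam_placable (hgen : GeneralPosition n v y) (hsolid : Solid n v k) {A R : Finset ι} {x : ι}
    (hxR : x ∈ R) (hx : v x ∉ Submodule.span ℝ (v '' (A : Set ι))) :
    ∀ B ∈ Fam v y k A R, Sum.inl x ∉ B → ∃ a ∈ B, insert (Sum.inl x) (B.erase a) ∈ Fam v y k A R := by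
  rintro B ⟨⟨hB, hBk⟩, hAB, hBR⟩ hxB
  have hcard := aux_basis_card hB
  set I := leftPart B with hI
  have hxI : x ∉ I := by rwa [hI, mem_leftPart]
  have hmono : ∀ S T : Finset ι, S ⊆ T → k S ≤ k T := fun S T h => hsolid S T (aux_mono h)
  by_cases h : v x ∈ Submodule.span ℝ (v '' (I : Set ι))
  · have hI' : A ∪ (I \ A) = I := Finset.union_sdiff_of_subset hAB
    obtain ⟨i, hi, hs⟩ := aux_exchange A (I \ A) x Finset.disjoint_sdiff (by rw [hI']; exact h) hx
    rw [hI'] at hs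
    rw [Finset.mem_sdiff] at hi
    have hiB : Sum.inl i ∈ B := mem_leftPart.mp hi.1
    have hl : leftPart (insert (Sum.inl x) (B.erase (Sum.inl i))) = insert x (I.erase i) := by
      ext z; simp [hI, mem_leftPart]
    have hc' : (insert (Sum.inl x) (B.erase (Sum.inl i))).card = n := by
      rw [Finset.card_insert_of_notMem (by simp [hxB]), Finset.card_erase_of_mem hiB, hcard]
      have := Finset.card_pos.mpr ⟨_, hiB⟩
      omega
    have hcI : (insert x (I.erase i)).card = I.card := by
      rw [Finset.card_insert_of_notMem (by simp [hxI]), Finset.card_erase_of_mem hi.1]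
      have := Finset.card_pos.mpr ⟨_, hi.1⟩
      omega
    have hk : k I ≤ k (insert x (I.erase i)) := by
      apply hsolid
      rw [Submodule.span_le]
      rintro _ ⟨z, hz, rfl⟩
      by_cases hzi : z = i
      · rw [hzi]; exact hs
      · exact Submodule.subset_span ⟨z, by simp [hzi]; right; exact hz, rfl⟩
    refine ⟨Sum.inl i, hiB, ⟨aux_basis_of_span ?_ hc', ?_⟩, ?_, ?_⟩
    · rw [eq_top_iff, ← hB.2, Submodule.span_le]
      rintro _ ⟨z, hz, rfl⟩
      by_cases hzi : z = Sum.inl i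
      · rw [hzi]
        have : ((insert x (I.erase i)).image Sum.inl : Finset (ι ⊕ Fin M)) ⊆
            insert (Sum.inl x) (B.erase (Sum.inl i)) := by
          intro q hq
          obtain ⟨r, hr, rfl⟩ := Finset.mem_image.mp hq
          rw [← hl, mem_leftPart] at hr
          exact hr
        refine aux_mono this ?_
        rw [aux_img]
        exact hs
      · exact Submodule.subset_span ⟨z, by simp [hzi]; right; exact hz, rfl⟩
    · intro j hj
      rw [hl]
      have := hBk j (by simpa using hj)
      unfold mVal at *
      rw [hcI]
      omega
    · rw [hl]
      intro z hz
      have : z ≠ i := by rintro rfl; exact hi.2 hz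
      simp [this, hAB hz]
    · rw [hl]
      intro z hz
      simp only [Finset.mem_insert, Finset.mem_erase] at hz
      rcases hz with rfl | hz
      · simp [hxR]
      · exact hBR hz.2
  · have hne : (rightPart B).Nonempty := by
      rw [Finset.nonempty_iff_ne_empty]
      intro he
      have hs := card_split B
      rw [he, Finset.image_empty, Finset.union_empty] at hs
      apply h
      have h2 := hB.2
      rw [← hs, aux_img] at h2
      rw [h2]; trivial
    obtain ⟨j, hj, hmax⟩ := Finset.exists_max_image (rightPart B) id hne
    have hjB : Sum.inr j ∈ B := by simpa [rightPart] using hj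
    have hl : leftPart (insert (Sum.inl x) (B.erase (Sum.inr j))) = insert x I := by
      ext z; simp [hI, mem_leftPart]
    have hc' : (insert (Sum.inl x) (B.erase (Sum.inr j))).card = n := by
      rw [Finset.card_insert_of_notMem (by simp [hxB]), Finset.card_erase_of_mem hjB, hcard]
      have := Finset.card_pos.mpr ⟨_, hjB⟩
      omega
    refine ⟨Sum.inr j, hjB, ⟨aux_basis_of_indep ?_ hc', ?_⟩, ?_, ?_⟩
    · have hi := aux_indep_inl (y := y) (aux_indep_insert (aux_indep_left hB.1) h)
      have he : insert (Sum.inl x) (B.erase (Sum.inr j)) =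
          (insert x I).image Sum.inl ∪ ((rightPart B).erase j).image Sum.inr := by
        ext z
        rcases z with z | z <;> simp [leftPart, rightPart, hI]
      rw [he] at hc' ⊢
      refine aux_ext hi ?_ hc'.le
      intro z hz
      obtain ⟨j', _, rfl⟩ := Finset.mem_image.mp hz
      exact aux_gp hgen j'
    · intro j' hj'
      rw [hl]
      have hj2 : j' ≠ j ∧ Sum.inr j' ∈ B := by simpa using hj'
      have h1 := hBk j hjB
      have h2 : j' ≤ j := hmax j' (by simpa [rightPart] using hj2.2)
      have h3 : (j' : ℕ) < j := lt_of_le_of_ne h2 (fun h => hj2.1 (Fin.ext h))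
      have h4 := hmono I (insert x I) (Finset.subset_insert _ _)
      unfold mVal at *
      rw [Finset.card_insert_of_notMem hxI]
      omega
    · rw [hl]; exact hAB.trans (Finset.subset_insert _ _)
    · rw [hl]
      intro z hz
      rcases Finset.mem_insert.mp hz with rfl | hz
      · simp [hxR]
      · exact hBR hz

noncomputable def Prel (v : ι → Fin n → ℝ) (k : Finset ι → ℕ) (A R : Finset ι) :
    Submodule ℝ (MvPolynomial (Fin n) ℝ) :=
  Submodule.span ℝ {f | ∃ Z ⊆ R, ∃ r : MvPolynomial (Fin n) ℝ, r.totalDegree ≤ k (Z ∪ A) ∧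
    f = pProd n v (R \ Z) * r}

theorem Prel_le_Pspace : Prel v k ∅ Finset.univ ≤ Pspace n v k := by
  unfold Prel
  rw [Submodule.span_le]
  rintro f ⟨Z, _, r, hr, rfl⟩
  refine Submodule.mem_iSup_of_mem Z ⟨r, ?_, rfl⟩
  rw [SetLike.mem_coe, mem_restrictTotalDegree]
  simpa using hr

theorem main_sum (hgen : GeneralPosition n v y) (hsolid : Solid n v k)
    (hM : ∀ I : Finset ι, (LinearIndependent ℝ fun i : I => v i) → mVal n k I ≤ M)
    (R : Finset ι) : ∀ A : Finset ι, LinearIndepOn ℝ v (A : Set ι) → Disjoint A R →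
    (Jideal n (Sum.elim v y) (Fam v y k A R)).restrictScalars ℝ ⊔ Prel v k A R = ⊤ := by
  induction R using Finset.induction_on with
  | empty =>
    intro A hA _
    rw [Fam_base hgen hM hA]
    have h := aux_baseJ (n := n) (w := Sum.elim v y)
      ((YFin (M := M) (mVal n k A)).image Sum.inr) (A.image Sum.inl) (k A) (aux_indep_inl hA)
      (by
        rw [Finset.disjoint_left]
        intro z hz hz'
        obtain ⟨i, _, rfl⟩ := Finset.mem_image.mp hz
        simp at hz')
      (by
        intro z hz
        obtain ⟨j, _, rfl⟩ := Finset.mem_image.mp hz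
        exact aux_gp hgen j)
      (by
        rw [Finset.card_image_of_injective _ Sum.inl_injective,
          Finset.card_image_of_injective _ Sum.inr_injective, YFin_card (hM A hA)]
        have := aux_card_le hA
        unfold mVal; omega)
    rw [eq_top_iff, ← h]
    refine sup_le_sup_left ?_ _
    intro r hr
    rw [mem_restrictTotalDegree] at hr
    exact Submodule.subset_span ⟨∅, by simp, r, by simpa using hr, by simp [pProd]⟩
  | insert x R hxR ih =>
    intro A hA hAR
    rw [Finset.disjoint_insert_right] at hAR
    by_cases hx : v x ∈ Submodule.span ℝ (v '' (A : Set ι))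
    · rw [eq_top_iff, ← ih A hA hAR.2]
      refine sup_le_sup ?_ ?_
      · intro f hf
        exact aux_Jmono (Fam_loop hAR.1 hx) hf
      · refine Submodule.span_le.mpr ?_
        rintro f ⟨Z, hZ, r, hr, rfl⟩
        refine Submodule.subset_span ⟨insert x Z, Finset.insert_subset_insert _ hZ, r,
          hr.trans (hsolid _ _ (aux_mono ?_)), ?_⟩
        · rw [Finset.insert_union]; exact Finset.subset_insert _ _
        · congr 2
          ext z; simp only [Finset.mem_sdiff, Finset.mem_insert]
          constructor
          · rintro ⟨a, b⟩
            refine ⟨Or.inr a, ?_⟩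
            rintro (rfl | h)
            · exact hxR a
            · exact b h
          · tauto
    · have i1 := ih (insert x A) (aux_indep_insert hA hx)
        (by rw [Finset.disjoint_insert_left]; exact ⟨hxR, hAR.2⟩)
      have i2 := ih A hA hAR.2
      rw [← Fam_in] at i1
      rw [← Fam_out hAR.1 hxR] at i2
      refine aux_split (Fam_placable hgen hsolid (by simp) hx) i1 i2 ?_ ?_
      · refine Submodule.span_le.mpr ?_
        rintro f ⟨Z, hZ, r, hr, rfl⟩
        refine Submodule.subset_span ⟨insert x Z, Finset.insert_subset_insert _ hZ, r, ?_, ?_⟩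
        · rwa [Finset.insert_union, ← Finset.union_insert]
        · congr 2
          ext z; simp only [Finset.mem_sdiff, Finset.mem_insert]
          constructor
          · rintro ⟨a, b⟩
            refine ⟨Or.inr a, ?_⟩
            rintro (rfl | h)
            · exact hxR a
            · exact b h
          · tauto
      · intro p hp
        induction hp using Submodule.span_induction with
        | mem f hf =>
          obtain ⟨Z, hZ, r, hr, rfl⟩ := hf
          refine Submodule.subset_span ⟨Z, hZ.trans (Finset.subset_insert _ _), r, hr, ?_⟩
          rw [Finset.insert_sdiff_of_notMem _ (fun h => hxR (hZ h))]
          unfold pProd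
          rw [Finset.prod_insert (by simp [hxR]), mul_assoc]
          rfl
        | zero => simp
        | add a b _ _ ha hb => rw [mul_add]; exact Submodule.add_mem _ ha hb
        | smul c a _ ha => rw [mul_smul_comm]; exact Submodule.smul_mem _ _ ha

theorem main_pts (hgen : GeneralPosition n v y) (hsolid : Solid n v k)
    (hM : ∀ I : Finset ι, (LinearIndependent ℝ fun i : I => v i) → mVal n k I ≤ M)
    {lam : ι ⊕ Fin M → ℝ} {θ : Finset (ι ⊕ Fin M) → Fin n → ℝ}
    (hθ : ∀ B, IsBasisSet n (Sum.elim v y) B → (∀ b ∈ B, Sum.elim v y b ⬝ᵥ θ B = lam b) ∧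
      ∀ z, z ∉ B → Sum.elim v y z ⬝ᵥ θ B ≠ lam z)
    (R : Finset ι) : ∀ A : Finset ι, LinearIndepOn ℝ v (A : Set ι) → Disjoint A R →
    ∀ f : MvPolynomial (Fin n) ℝ,
    (∀ F ⊆ R, ∀ t ∈ LA (Sum.elim v y) lam (A.image Sum.inl), ∀ η : Fin n → ℝ,
      (∀ a ∈ (A ∪ F).image Sum.inl, Sum.elim v y a ⬝ᵥ η = 0) →
        (lineP f t η).natDegree ≤ (R \ F).card + k (A ∪ F)) →
    (∀ B ∈ Fam v y k A R, MvPolynomial.eval (θ B) f = 0) →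
    ∀ t ∈ LA (Sum.elim v y) lam (A.image Sum.inl), MvPolynomial.eval t f = 0 := by
  induction R using Finset.induction_on with
  | empty =>
    intro A hA _ f hf hv
    rw [Fam_base hgen hM hA] at hv
    refine aux_basePts (n := n) (w := Sum.elim v y) hθ
      ((YFin (M := M) (mVal n k A)).image Sum.inr) (A.image Sum.inl) (k A) (aux_indep_inl hA)
      (by
        rw [Finset.disjoint_left]
        intro z hz hz'
        obtain ⟨i, _, rfl⟩ := Finset.mem_image.mp hz
        simp at hz')
      (by
        intro z hz
        obtain ⟨j, _, rfl⟩ := Finset.mem_image.mp hz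
        exact aux_gp hgen j)
      (by
        rw [Finset.card_image_of_injective _ Sum.inl_injective,
          Finset.card_image_of_injective _ Sum.inr_injective, YFin_card (hM A hA)]
        have := aux_card_le hA
        unfold mVal; omega) f ?_ hv
    intro t ht η hη
    have := hf ∅ (by simp) t ht η (by simpa using hη)
    simpa using this
  | insert x R hxR ih =>
    intro A hA hAR f hf hv
    rw [Finset.disjoint_insert_right] at hAR
    by_cases hx : v x ∈ Submodule.span ℝ (v '' (A : Set ι))
    · refine ih A hA hAR.2 f ?_ ?_
      · intro F hF t ht η hη
        have hxF : x ∉ F := fun h => hxR (hF h)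
        have h := hf (insert x F) (Finset.insert_subset_insert _ hF) t ht η (by
          intro a ha
          rw [Finset.union_insert, Finset.image_insert, Finset.mem_insert] at ha
          rcases ha with rfl | ha
          · refine aux_perp_span (w := Sum.elim v y) (S := (A ∪ F).image Sum.inl) ?_ hη
            rw [aux_img]
            exact aux_mono Finset.subset_union_left hx
          · exact hη a ha)
        have e1 : insert x R \ insert x F = R \ F := by
          ext z; simp only [Finset.mem_sdiff, Finset.mem_insert]
          constructor
          · tauto
          · rintro ⟨a, b⟩
            refine ⟨Or.inr a, ?_⟩
            rintro (rfl | h)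
            · exact hxR a
            · exact b h
        have e2 : k (A ∪ insert x F) ≤ k (A ∪ F) := by
          apply hsolid
          rw [Finset.union_insert, Finset.coe_insert, Set.image_insert_eq, Submodule.span_le]
          rintro _ (rfl | hu)
          · exact aux_mono Finset.subset_union_left hx
          · exact Submodule.subset_span hu
        rw [e1] at h
        omega
      · intro B hB
        refine hv B ?_
        rw [← Fam_out hAR.1 hxR] at hB
        exact hB.1
    · have hx2 : Sum.elim v y (Sum.inl x) ∉ Submodule.span ℝ
          (Sum.elim v y '' ((A.image Sum.inl : Finset (ι ⊕ Fin M)) : Set (ι ⊕ Fin M))) := by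
        rw [aux_img]; exact hx
      have sd : ∀ F ⊆ R, insert x R \ insert x F = R \ F := by
        intro F hF
        ext z; simp only [Finset.mem_sdiff, Finset.mem_insert]
        constructor
        · tauto
        · rintro ⟨a, b⟩
          refine ⟨Or.inr a, ?_⟩
          rintro (rfl | h)
          · exact hxR a
          · exact b h
      have i1 := ih (insert x A) (aux_indep_insert hA hx)
        (by rw [Finset.disjoint_insert_left]; exact ⟨hxR, hAR.2⟩) f (by
          intro F hF t ht η hη
          have h := hf (insert x F) (Finset.insert_subset_insert _ hF) t
            (fun a ha => ht a (by rw [Finset.image_insert]; simp only [Finset.mem_insert]; exact Or.inr ha))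
            η (by rwa [Finset.union_insert, ← Finset.insert_union])
          rwa [sd F hF, Finset.union_insert, ← Finset.insert_union] at h)
        (by
          intro B hB
          rw [← Fam_in] at hB
          exact hv B hB.1)
      rw [Finset.image_insert] at i1
      obtain ⟨g, hg⟩ := aux_div hx2 f i1
      have i2 := ih A hA hAR.2 g (by
        intro F hF
        have hsub : (A.image Sum.inl : Finset (ι ⊕ Fin M)) ⊆ (A ∪ F).image Sum.inl :=
          Finset.image_subset_image Finset.subset_union_left
        by_cases hxF : v x ∈ Submodule.span ℝ (v '' ((A ∪ F : Finset ι) : Set ι))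
        · have hxF2 : Sum.elim v y (Sum.inl x) ∈ Submodule.span ℝ (Sum.elim v y ''
              (((A ∪ F).image Sum.inl : Finset (ι ⊕ Fin M)) : Set (ι ⊕ Fin M))) := by
            rw [aux_img]; exact hxF
          refine aux_degB hsub hg hx2 hxF2 ?_
          intro t ht η hη
          have h := hf (insert x F) (Finset.insert_subset_insert _ hF) t ht η (by
            intro a ha
            rw [Finset.union_insert, Finset.image_insert, Finset.mem_insert] at ha
            rcases ha with rfl | ha
            · exact aux_perp_span (w := Sum.elim v y) (S := (A ∪ F).image Sum.inl) hxF2 hη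
            · exact hη a ha)
          have e2 : k (A ∪ insert x F) ≤ k (A ∪ F) := by
            apply hsolid
            rw [Finset.union_insert, Finset.coe_insert, Set.image_insert_eq, Submodule.span_le]
            rintro _ (rfl | hu)
            · exact hxF
            · exact Submodule.subset_span hu
          rw [sd F hF] at h
          omega
        · refine aux_degA hsub hg (by rw [aux_img]; exact hxF) ?_
          intro t ht η hη
          have h := hf F (hF.trans (Finset.subset_insert _ _)) t ht η hη
          rw [Finset.insert_sdiff_of_notMem _ (fun h => hxR (hF h)),
            Finset.card_insert_of_notMem (by simp [hxR])] at h
          omega)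
        (by
          intro B hB
          rw [← Fam_out hAR.1 hxR] at hB
          have h0 := hv B hB.1
          have hb := hθ B hB.1.1.1
          rw [hg _ (fun a ha => by
            obtain ⟨i, hi, rfl⟩ := Finset.mem_image.mp ha
            exact hb.1 _ (mem_leftPart.mp (hB.1.2.1 hi)))] at h0
          exact (mul_eq_zero.mp h0).resolve_left (sub_ne_zero.mpr (hb.2 _ hB.2)))
      intro t ht
      rw [hg t ht, i2 t ht, mul_zero]


def LowP (n d : ℕ) : Submodule ℝ (MvPolynomial (Fin n) ℝ) where
  carrier := {h | ∀ m, d ≤ Finsupp.degree m → coeff m h = 0}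
  zero_mem' := by intro m _; simp
  add_mem' := by intro a b ha hb m hm; rw [coeff_add, ha m hm, hb m hm, add_zero]
  smul_mem' := by intro c a ha m hm; rw [coeff_smul, ha m hm, smul_zero]

theorem LowP_mono {d e : ℕ} (h : d ≤ e) : LowP n d ≤ LowP n e := fun _ ha m hm => ha m (h.trans hm)

theorem LowP_mul {d e : ℕ} {f g : MvPolynomial (Fin n) ℝ} (hf : f ∈ LowP n d) (hg : g ∈ LowP n (e + 1)) :
    f * g ∈ LowP n (d + e) := by
  intro m hm
  rw [coeff_mul]
  refine Finset.sum_eq_zero fun q hq => ?_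
  have hq' := Finset.HasAntidiagonal.mem_antidiagonal.mp hq
  have hdeg : Finsupp.degree q.1 + Finsupp.degree q.2 = Finsupp.degree m := by
    rw [← hq', map_add]
  by_cases h : d ≤ Finsupp.degree q.1
  · rw [hf _ h, zero_mul]
  · rw [hg q.2 (by omega), mul_zero]

theorem LowP_of_hom {d : ℕ} {f : MvPolynomial (Fin n) ℝ} (hf : f.IsHomogeneous d) : f ∈ LowP n (d + 1) := by
  intro m hm
  exact hf.coeff_eq_zero (by omega)

theorem pLin_hom (u : Fin n → ℝ) : (pLin n u).IsHomogeneous 1 := by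
  refine IsHomogeneous.sum _ _ _ fun i _ => ?_
  have := (isHomogeneous_C (Fin n) (u i)).mul (isHomogeneous_X ℝ i)
  simpa using this

theorem pProd_hom {κ : Type} (w : κ → Fin n → ℝ) (Z : Finset κ) : (pProd n w Z).IsHomogeneous Z.card := by
  have := IsHomogeneous.prod Z (fun a => pLin n (w a)) (fun _ => 1) (fun a _ => pLin_hom _)
  simpa [pProd] using this

theorem qProd_low {κ : Type} [DecidableEq κ] (w : κ → Fin n → ℝ) (lam : κ → ℝ) (Z : Finset κ) :
    pProd n w Z - qProd n w lam Z ∈ LowP n Z.card := by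
  induction Z using Finset.induction_on with
  | empty => simp [pProd, qProd]
  | insert a Z ha ih =>
    have e : pProd n w (insert a Z) - qProd n w lam (insert a Z) =
        (pProd n w Z - qProd n w lam Z) * pLin n (w a) +
        lam a • (pProd n w Z - (pProd n w Z - qProd n w lam Z)) := by
      unfold pProd qProd
      rw [Finset.prod_insert ha, Finset.prod_insert ha, smul_eq_C_mul]
      ring
    rw [e, Finset.card_insert_of_notMem ha]
    refine Submodule.add_mem _ (LowP_mul ih (LowP_of_hom (pLin_hom _))) (Submodule.smul_mem _ _ ?_)
    exact Submodule.sub_mem _ (LowP_of_hom (pProd_hom _ _)) (LowP_mono (Nat.le_succ _) ih)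

/-- polynomials vanishing on a set of points -/
def VanP (n : ℕ) (T : Set (Fin n → ℝ)) : Submodule ℝ (MvPolynomial (Fin n) ℝ) where
  carrier := {h | ∀ t ∈ T, MvPolynomial.eval t h = 0}
  zero_mem' := by intro m _; simp
  add_mem' := by intro a b ha hb m hm; rw [map_add, ha m hm, hb m hm, add_zero]
  smul_mem' := by intro c a ha m hm; rw [smul_eval, ha m hm, mul_zero]

theorem hc_of_hom {d e : ℕ} {f : MvPolynomial (Fin n) ℝ} (hf : f.IsHomogeneous e) :
    homogeneousComponent d f = if d = e then f else 0 :=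
  homogeneousComponent_of_mem (by simpa using hf)

theorem hc_J {κ : Type} [DecidableEq κ] {w : κ → Fin n → ℝ} {lam : κ → ℝ} {F : Set (Finset κ)}
    {T : Set (Fin n → ℝ)} (hT : ∀ t ∈ T, ∃ B ∈ F, ∀ b ∈ B, w b ⬝ᵥ t = lam b)
    {j : MvPolynomial (Fin n) ℝ} (hj : j ∈ Jideal n w F) (d : ℕ) :
    homogeneousComponent d j ∈ VanP n T ⊔ LowP n d := by
  induction hj using Submodule.closure_induction with
  | zero => simp
  | add a b _ _ ha hb => rw [map_add]; exact Submodule.add_mem _ ha hb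
  | smul_mem r f hf =>
    obtain ⟨Z, hZ, rfl⟩ := hf
    rw [smul_eq_mul]
    induction r using MvPolynomial.induction_on' with
    | add a b ha hb => rw [add_mul, map_add]; exact Submodule.add_mem _ ha hb
    | monomial m c =>
      have hm : (monomial m c : MvPolynomial (Fin n) ℝ).IsHomogeneous (Finsupp.degree m) :=
        isHomogeneous_monomial _ rfl
      rw [hc_of_hom (hm.mul (pProd_hom w Z))]
      split_ifs with h
      swap
      · exact Submodule.zero_mem _
      have e : monomial m c * pProd n w Z = monomial m c * qProd n w lam Z +
          (pProd n w Z - qProd n w lam Z) * monomial m c := by ring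
      rw [e]
      refine Submodule.add_mem _ (Submodule.mem_sup_left ?_) (Submodule.mem_sup_right ?_)
      · intro t ht
        obtain ⟨B, hB, hb⟩ := hT t ht
        obtain ⟨z, hz⟩ := hZ B hB
        rw [Finset.mem_inter] at hz
        rw [map_mul, qProd, map_prod, Finset.prod_eq_zero hz.1, mul_zero]
        rw [map_sub, aux_eval_pLin, eval_C, hb z hz.2, sub_self]
      · rw [h, add_comm]
        exact LowP_mul (qProd_low w lam Z) (LowP_of_hom hm)

theorem hc_P {p : MvPolynomial (Fin n) ℝ} (hp : p ∈ Pspace n v k) (d : ℕ) :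
    homogeneousComponent d p ∈ Pspace n v k := by
  suffices h : Pspace n v k ≤ (Pspace n v k).comap (homogeneousComponent d) from h hp
  refine iSup_le fun Z => ?_
  rintro _ ⟨r, hr, rfl⟩
  rw [SetLike.mem_coe, mem_restrictTotalDegree] at hr
  rw [Submodule.mem_comap, LinearMap.mulLeft_apply]
  rw [r.as_sum, Finset.mul_sum, map_sum]
  refine Submodule.sum_mem _ fun m hm => ?_
  have hm' : (monomial m (coeff m r) : MvPolynomial (Fin n) ℝ).IsHomogeneous (Finsupp.degree m) :=
    isHomogeneous_monomial _ rfl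
  rw [hc_of_hom ((pProd_hom v _).mul hm')]
  split_ifs with h
  swap
  · exact Submodule.zero_mem _
  refine Submodule.mem_iSup_of_mem Z ⟨_, ?_, rfl⟩
  rw [SetLike.mem_coe, mem_restrictTotalDegree]
  refine (totalDegree_monomial_le _ _).trans (le_trans ?_ hr)
  exact le_totalDegree hm

theorem hc_low {d : ℕ} {f : MvPolynomial (Fin n) ℝ} (hf : f ∈ LowP n d) : homogeneousComponent d f = 0 := by
  ext m
  rw [coeff_homogeneousComponent, coeff_zero]
  split_ifs with h
  · exact hf m h.ge
  · rfl

theorem low_sub_hc {d : ℕ} {f : MvPolynomial (Fin n) ℝ} (hf : f ∈ LowP n (d + 1)) :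
    f - homogeneousComponent d f ∈ LowP n d := by
  intro m hm
  rw [coeff_sub, coeff_homogeneousComponent]
  split_ifs with h
  · simp
  · rw [hf m (by omega), sub_zero]

theorem graded_final {J P V : Submodule ℝ (MvPolynomial (Fin n) ℝ)} (hJP : J ⊔ P = ⊤)
    (hPV : ∀ p ∈ P, p ∈ V → p = 0) (hP : ∀ p ∈ P, ∀ d, homogeneousComponent d p ∈ P)
    (hJ : ∀ j ∈ J, ∀ d, homogeneousComponent d j ∈ V ⊔ LowP n d) : J ⊓ P = ⊥ := by
  have key : ∀ d, LowP n d ≤ V ⊔ (P ⊓ LowP n d) := by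
    intro d
    induction d with
    | zero =>
      intro f hf
      have : f = 0 := by ext m; rw [hf m (Nat.zero_le _), coeff_zero]
      rw [this]; exact Submodule.zero_mem _
    | succ d ih =>
      have ih' : LowP n d ≤ V ⊔ (P ⊓ LowP n (d + 1)) :=
        ih.trans (sup_le_sup_left (inf_le_inf_left _ (LowP_mono (Nat.le_succ _))) _)
      intro f hf
      have hf2 : f ∈ J ⊔ P := by rw [hJP]; trivial
      obtain ⟨j, hj, p, hp, e⟩ := Submodule.mem_sup.mp hf2
      have e2 : f = (f - homogeneousComponent d f) + homogeneousComponent d j +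
          homogeneousComponent d p := by
        rw [add_assoc, ← map_add, e, sub_add_cancel]
      rw [e2]
      refine Submodule.add_mem _ (Submodule.add_mem _ (ih' (low_sub_hc hf)) ?_) ?_
      · exact (sup_le le_sup_left ih' : V ⊔ LowP n d ≤ _) (hJ j hj d)
      · exact Submodule.mem_sup_right ⟨hP p hp d, LowP_of_hom (homogeneousComponent_isHomogeneous d p)⟩
  rw [eq_bot_iff]
  rintro f ⟨hfJ, hfP⟩
  rw [Submodule.mem_bot, ← sum_homogeneousComponent f]
  refine Finset.sum_eq_zero fun d _ => ?_
  have h1 : homogeneousComponent d f ∈ V ⊔ (P ⊓ LowP n d) :=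
    (sup_le le_sup_left (key d) : V ⊔ LowP n d ≤ _) (hJ f hfJ d)
  obtain ⟨i, hi, p, hp, e⟩ := Submodule.mem_sup.mp h1
  have hi0 : i = 0 := by
    refine hPV i ?_ hi
    rw [eq_sub_of_add_eq e]
    exact Submodule.sub_mem _ (hP f hfP d) hp.1
  rw [hi0, zero_add] at e
  have h2 := hc_low hp.2
  rw [e, hc_of_hom (homogeneousComponent_isHomogeneous d f), if_pos rfl] at h2
  exact h2

theorem k_incr (hinc : Incremental k) (F Z : Finset ι) : k (F ∪ Z) ≤ k F + (Z \ F).card := by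
  induction Z using Finset.induction_on with
  | empty => simp
  | insert z Z hz ih =>
    by_cases hzF : z ∈ F
    · rw [Finset.union_insert, Finset.insert_eq_of_mem (by simp [hzF]),
        Finset.insert_sdiff_of_mem _ hzF]
      exact ih
    · rw [Finset.union_insert, Finset.insert_sdiff_of_notMem _ hzF,
        Finset.card_insert_of_notMem (by simp [hz])]
      have := hinc (F ∪ Z) z
      omega

theorem P_sub_K (hsolid : Solid n v k) (hinc : Incremental k) (F : Finset ι) (t η : Fin n → ℝ)
    (hη : ∀ a ∈ F, v a ⬝ᵥ η = 0) {p : MvPolynomial (Fin n) ℝ} (hp : p ∈ Pspace n v k) :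
    (lineP p t η).natDegree ≤ (Finset.univ \ F).card + k F := by
  have hz : ∀ Z : Finset ι, ∀ r : MvPolynomial (Fin n) ℝ, r.totalDegree ≤ k Z →
      (lineP (pProd n v (Finset.univ \ Z) * r) t η).natDegree ≤ (Finset.univ \ F).card + k F := by
    intro Z r hr
    have h1 : (lineP r t η).natDegree ≤ k Z := by
      have := MvPolynomial.aeval_natDegree_le (n := 1) r hr
        (fun i => Polynomial.C (t i) + Polynomial.C (η i) * Polynomial.X) (by
          intro i; rw [add_comm]; exact Polynomial.natDegree_linear_le)
      simpa [lineP] using this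
    have h2 : ∀ S : Finset ι, (lineP (pProd n v S) t η).natDegree ≤ (S \ F).card := by
      intro S
      have e : lineP (pProd n v S) t η = ∏ a ∈ S, lineP (pLin n (v a)) t η := by
        simp only [lineP, pProd, map_prod]
      rw [e]
      refine (Polynomial.natDegree_prod_le _ _).trans ?_
      rw [← Finset.filter_notMem_eq_sdiff, Finset.card_filter]
      refine Finset.sum_le_sum fun a _ => ?_
      rw [lineP_pLin]
      by_cases h : a ∈ F
      · rw [hη a h]; simp
      · rw [if_pos h, add_comm]; exact Polynomial.natDegree_linear_le
    have e : lineP (pProd n v (Finset.univ \ Z) * r) t η =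
        lineP (pProd n v (Finset.univ \ Z)) t η * lineP r t η := by simp only [lineP, map_mul]
    rw [e]
    refine Polynomial.natDegree_mul_le.trans ?_
    have h3 := h2 (Finset.univ \ Z)
    have h4 := k_incr hinc F Z
    have h5 : k Z ≤ k (F ∪ Z) := hsolid _ _ (aux_mono Finset.subset_union_right)
    have h6 : ((Finset.univ \ Z) \ F).card + (Z \ F).card = (Finset.univ \ F).card := by
      rw [← Finset.card_union_of_disjoint]
      · congr 1
        ext z; simp only [Finset.mem_union, Finset.mem_sdiff, Finset.mem_univ, true_and]; tauto
      · rw [Finset.disjoint_left]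
        intro z; simp only [Finset.mem_sdiff, Finset.mem_univ, true_and]; tauto
    omega
  let Q : Submodule ℝ (MvPolynomial (Fin n) ℝ) :=
    (Polynomial.degreeLE ℝ ((Finset.univ \ F).card + k F : ℕ)).comap
      (MvPolynomial.aeval (fun i => Polynomial.C (t i) + Polynomial.C (η i) * Polynomial.X) :
        MvPolynomial (Fin n) ℝ →ₐ[ℝ] Polynomial ℝ).toLinearMap
  have hQ : ∀ p, p ∈ Q ↔ (lineP p t η).natDegree ≤ (Finset.univ \ F).card + k F := by
    intro p
    rw [Polynomial.natDegree_le_iff_degree_le]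
    exact Polynomial.mem_degreeLE
  rw [← hQ]
  suffices h : Pspace n v k ≤ Q from h hp
  refine iSup_le fun Z => ?_
  rintro _ ⟨r, hr, rfl⟩
  rw [SetLike.mem_coe, mem_restrictTotalDegree] at hr
  rw [LinearMap.mulLeft_apply, hQ]
  exact hz Z r hr

theorem Fam_full : Fam v y k ∅ Finset.univ = Bk n v y k := by
  ext B; simp [Fam]

end main

/-- for a solid and incremental assignment, `𝒥_k ⊕ 𝒫_k = Π`:
`𝒥_k ∩ 𝒫_k = {0}` and `𝒥_k + 𝒫_k = Π`. -/
theorem statement13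
    (n : ℕ) (hn : 1 ≤ n) (ι : Type) [Fintype ι] [DecidableEq ι]
    (v : ι → Fin n → ℝ) (M : ℕ) (y : Fin M → Fin n → ℝ)
    (hspan : Submodule.span ℝ (Set.range (Sum.elim v y)) = ⊤)
    (hgen : GeneralPosition n v y)
    (k : Finset ι → ℕ) (hsolid : Solid n v k)
    (hM : ∀ I : Finset ι, (LinearIndependent ℝ fun i : I => v i) → mVal n k I ≤ M)
    (hinc : Incremental k) :
    ((Jideal n (Sum.elim v y) (Bk n v y k)).restrictScalars ℝ ⊓ Pspace n v k = ⊥) ∧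
    ((Jideal n (Sum.elim v y) (Bk n v y k)).restrictScalars ℝ ⊔ Pspace n v k = ⊤) := by
  have hempty : LinearIndepOn ℝ v ((∅ : Finset ι) : Set ι) := by simp
  have hsum : (Jideal n (Sum.elim v y) (Bk n v y k)).restrictScalars ℝ ⊔ Pspace n v k = ⊤ := by
    have h := main_sum hgen hsolid hM Finset.univ ∅ hempty (by simp)
    rw [Fam_full] at h
    rw [eq_top_iff, ← h]
    exact sup_le_sup_left Prel_le_Pspace _
  refine ⟨?_, hsum⟩
  obtain ⟨lam, θ, hθ⟩ := aux_generic (Sum.elim v y)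
  refine graded_final (V := VanP n (θ '' Bk n v y k)) hsum ?_ (fun p hp d => hc_P hp d) ?_
  · intro p hp hpV
    have h := main_pts hgen hsolid hM hθ Finset.univ ∅ hempty (by simp) p (by
      intro F _ t _ η hη
      have := P_sub_K hsolid hinc F t η (fun a ha => hη (Sum.inl a) (by simp [ha])) hp
      simpa using this)
      (by
        intro B hB
        rw [Fam_full] at hB
        exact hpV _ ⟨B, hB, rfl⟩)
    apply MvPolynomial.funext
    intro t
    rw [map_zero]
    exact h t (by intro a ha; simp at ha)
  · intro j hj d
    refine hc_J (lam := lam) ?_ hj d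
    rintro _ ⟨B, hB, rfl⟩
    exact ⟨B, hB, (hθ B hB.1).1⟩
end

section
/- Let k : 2^X → ℕ be any assignment. Then #𝔹_k = Σ_{I ∈ 𝕀(X)} C(m(I), k(I)), where C(a,b) denotes the binomial coefficient; equivalently, each independent sub-multiset I of X extends in exactly C(m(I), k(I)) ways to a basis B ∈ 𝔹_k with B∩X = I. -/
open MvPolynomial

/-- `∑_{I ∈ 𝕀(X)} C(m(I), k(I))`. -/
noncomputable def indepSum (n : ℕ) (ι : Type) [Fintype ι] [DecidableEq ι]
    (v : ι → Fin n → ℝ) (k : Finset ι → ℕ) : ℕ := by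
  classical
  exact ∑ I ∈ Finset.univ.filter (fun I : Finset ι => LinearIndependent ℝ fun i : I => v i),
    Nat.choose (mVal n k I) (k I)

theorem aux_indep (n : ℕ) (ι : Type) [Fintype ι] [DecidableEq ι]
    (v : ι → Fin n → ℝ) (M : ℕ) (y : Fin M → Fin n → ℝ)
    (hgen : GeneralPosition n v y) (I : Finset ι)
    (hI : LinearIndependent ℝ fun i : I => v i) (J : Finset (Fin M)) :
    I.card + J.card ≤ n →
      LinearIndepOn ℝ (Sum.elim v y) (↑(I.disjSum J) : Set (ι ⊕ Fin M)) := by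
  induction J using Finset.induction_on with
  | empty =>
    intro _
    have h1 : (↑(I.disjSum (∅ : Finset (Fin M))) : Set (ι ⊕ Fin M)) = Sum.inl '' (↑I : Set ι) := by
      ext x; simp
    rw [h1]
    have h2 : LinearIndepOn ℝ v (↑I : Set ι) := hI
    exact LinearIndepOn.image_of_comp (s := (↑I : Set ι)) Sum.inl (Sum.elim v y) h2
  | insert a s ha ih =>
    intro hc
    rw [Finset.card_insert_of_notMem ha] at hc
    have h1 : (↑(I.disjSum (insert a s)) : Set (ι ⊕ Fin M))
        = insert (Sum.inr a) (↑(I.disjSum s) : Set (ι ⊕ Fin M)) := by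
      ext x; rcases x with x | x <;> simp
    have hna : Sum.inr a ∉ I.disjSum s := by simpa using ha
    rw [h1, linearIndepOn_insert (by simpa using ha)]
    refine ⟨ih (by omega), ?_⟩
    exact hgen a (I.disjSum s) hna (by rw [Finset.card_disjSum]; omega)

theorem aux_left {ι : Type} [Fintype ι] [DecidableEq ι] {M : ℕ} (I : Finset ι)
    (J : Finset (Fin M)) : leftPart (I.disjSum J) = I := by
  ext x; simp [leftPart]

theorem aux_decomp {ι : Type} [Fintype ι] [DecidableEq ι] {M : ℕ} (B : Finset (ι ⊕ Fin M)) :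
    (leftPart B).disjSum (rightPart B) = B := by
  ext x; rcases x with x | x <;> simp [leftPart, rightPart]

theorem aux_card {n : ℕ} {κ : Type} {w : κ → Fin n → ℝ} {B : Finset κ}
    (h : IsBasisSet n w B) : B.card = n := by
  have h1 := finrank_span_eq_card h.1
  have h2 : Set.range (fun b : B => w b) = w '' ↑B := by
    ext x; simp
  rw [h2, h.2] at h1
  simpa using h1.symm

theorem aux_basis {n : ℕ} {κ : Type} {w : κ → Fin n → ℝ} {B : Finset κ}
    (h : LinearIndependent ℝ (fun b : B => w b)) (hc : B.card = n) : IsBasisSet n w B := by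
  refine ⟨h, ?_⟩
  have h2 : Set.range (fun b : B => w b) = w '' ↑B := by
    ext x; simp
  rw [← h2]
  exact h.span_eq_top_of_card_eq_finrank' (by simpa using hc)

theorem aux_leftIndep {n : ℕ} {ι : Type} [Fintype ι] [DecidableEq ι]
    {v : ι → Fin n → ℝ} {M : ℕ} {y : Fin M → Fin n → ℝ} {B : Finset (ι ⊕ Fin M)}
    (h : IsBasisSet n (Sum.elim v y) B) :
    LinearIndependent ℝ fun i : (leftPart B : Finset ι) => v i := by
  have := h.1.comp (fun i : (leftPart B : Finset ι) =>
    (⟨Sum.inl i.1, by simpa [leftPart] using i.2⟩ : B)) (by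
      intro a b hab
      exact Subtype.ext (Sum.inl_injective (congrArg Subtype.val hab)))
  exact this

theorem aux_fiber
    (n : ℕ) (ι : Type) [Fintype ι] [DecidableEq ι]
    (v : ι → Fin n → ℝ) (M : ℕ) (y : Fin M → Fin n → ℝ)
    (hgen : GeneralPosition n v y)
    (k : Finset ι → ℕ)
    (I : Finset ι) (hI : LinearIndependent ℝ fun i : I => v i) (hM : mVal n k I ≤ M) :
      {B ∈ Bk n v y k | leftPart B = I}.ncard = Nat.choose (mVal n k I) (k I) := by
  have hIn : I.card ≤ n := by simpa using hI.fintype_card_le_finrank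
  have key : {B ∈ Bk n v y k | leftPart B = I} =
      ↑((Finset.powersetCard (n - I.card) (YFin (M := M) (mVal n k I))).image
        (fun J => I.disjSum J)) := by
    ext B
    simp only [Set.mem_setOf_eq, Finset.coe_image, Set.mem_image, Finset.mem_coe,
      Finset.mem_powersetCard, Bk]
    constructor
    · rintro ⟨⟨hB, hj⟩, rfl⟩
      refine ⟨rightPart B, ⟨?_, ?_⟩, aux_decomp B⟩
      · intro j h
        simp only [YFin, Finset.mem_filter, Finset.mem_univ, true_and]
        exact hj j (by simpa [rightPart] using h)
      · have h1 := aux_card hB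
        rw [← aux_decomp B, Finset.card_disjSum] at h1
        omega
    · rintro ⟨J, ⟨hJ, hc⟩, rfl⟩
      refine ⟨⟨aux_basis (aux_indep n ι v M y hgen I hI J (by omega))
        (by rw [Finset.card_disjSum]; omega), ?_⟩, aux_left I J⟩
      intro j h
      rw [aux_left]
      have := hJ (by simpa using h : j ∈ J)
      simpa [YFin] using this
  rw [key, Set.ncard_coe_finset, Finset.card_image_of_injective, Finset.card_powersetCard]
  · have hY : (YFin (M := M) (mVal n k I)).card = mVal n k I := by
      simp only [YFin]
      rw [Fin.card_filter_val_lt]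
      omega
    rw [hY]
    apply Nat.choose_symm_of_eq_add
    unfold mVal
    omega
  · intro J J' h
    have : ∀ j, j ∈ J ↔ j ∈ J' := fun j => by
      have := Finset.ext_iff.1 h (Sum.inr j)
      simpa using this
    exact Finset.ext this

/-- `#𝔹_k = ∑_{I ∈ 𝕀(X)} C(m(I), k(I))`; equivalently each independent
`I ⊆ X` extends in exactly `C(m(I), k(I))` ways to a basis `B ∈ 𝔹_k` with `B ∩ X = I`. -/
theorem statement16
    (n : ℕ) (hn : 1 ≤ n) (ι : Type) [Fintype ι] [DecidableEq ι]
    (v : ι → Fin n → ℝ) (M : ℕ) (y : Fin M → Fin n → ℝ)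
    (hspan : Submodule.span ℝ (Set.range (Sum.elim v y)) = ⊤)
    (hgen : GeneralPosition n v y)
    (k : Finset ι → ℕ)
    (hM : ∀ I : Finset ι, (LinearIndependent ℝ fun i : I => v i) → mVal n k I ≤ M) :
    (Bk n v y k).ncard = indepSum n ι v k ∧
    ∀ I : Finset ι, (LinearIndependent ℝ fun i : I => v i) →
      {B ∈ Bk n v y k | leftPart B = I}.ncard = Nat.choose (mVal n k I) (k I) := by
  classical
  refine ⟨?_, fun I hI => aux_fiber n ι v M y hgen k I hI (hM I hI)⟩
  have hfin : (Bk n v y k).Finite := Set.toFinite _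
  rw [Set.ncard_eq_toFinset_card _ hfin]
  rw [Finset.card_eq_sum_card_fiberwise (f := leftPart)
    (t := Finset.univ.filter (fun I : Finset ι => LinearIndependent ℝ fun i : I => v i))]
  · unfold indepSum
    refine Finset.sum_congr (by ext; simp) ?_
    intro I hI
    have hI' : LinearIndependent ℝ fun i : I => v i := by simpa using hI
    rw [← aux_fiber n ι v M y hgen k I hI' (hM I hI'), ← Set.ncard_coe_finset]
    congr 1
    ext B
    simp
  · intro B hB
    have hB' : B ∈ Bk n v y k := by simpa using hB
    simpa using aux_leftIndep hB'.1
end
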